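/- arXiv:2203.09861 — 2 statements merged into one kernel-verified Lean document; each statement's English description precedes it below -/
import Mathlib

section
/- Fix γ > −1. (i) 𝓣_γ maps μ^{2γ+1}C^∞_{α,+,+}(∂₊S𝔻) into itself. (ii) For φ = μ^{2γ+1}φ̃ and ψ = μ^{2γ+1}ψ̃ with φ̃, ψ̃ ∈ C^∞_{α,+,+}(∂₊S𝔻), one has ⟨𝓣_γφ, ψ⟩_{L²(μ^{−2γ} dβ dα)} = ⟨Tφ̃, Tψ̃⟩_{L²(μ^{2γ+2} dβ dα)} + (γ+1)²⟨φ̃, ψ̃⟩_{L²(μ^{2γ+2} dβ dα)}; in particular 𝓣_γ is symmetric on this domain and ⟨𝓣_γφ, φ⟩ ≥ 0. -/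
open MeasureTheory Complex Metric Real Set

noncomputable section

/-! ## Geometry of the Euclidean disk and its space of lines (fan-beam coordinates) -/

/-- The chord of the closed unit disk through the boundary point `exp (I β)` with incoming
direction `exp (I (β + π + α))`, parametrized by arclength `t ∈ [0, 2 cos α]`. -/
def chord (β α t : ℝ) : ℂ :=
  Complex.exp ((β : ℂ) * Complex.I) +
    (t : ℂ) * Complex.exp (((β + π + α : ℝ) : ℂ) * Complex.I)

/-- The X-ray transform `I₀` in fan-beam coordinates. -/
def XRT (f : ℂ → ℂ) (β α : ℝ) : ℂ :=
  ∫ t in (0:ℝ)..(2 * Real.cos α), f (chord β α t)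

/-- The fan-beam coordinate `α₋(z, θ)` of the unique chord through `z` with direction `exp (I θ)`,
determined by `sin α₋ = Im (z * exp (-I θ))`. -/
def alpham (z : ℂ) (θ : ℝ) : ℝ :=
  Real.arcsin ((z * Complex.exp (-(θ : ℂ) * Complex.I)).im)

/-- The fan-beam coordinate `β₋(z, θ)`, determined by `β₋ + α₋ + π = θ`. -/
def betam (z : ℂ) (θ : ℝ) : ℝ := θ - π - alpham z θ

/-- Reduction modulo `2π` to the fundamental interval `(0, 2π]`. -/
def wrap (x : ℝ) : ℝ := toIocMod Real.two_pi_pos 0 x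

/-- The backprojection operator `I₀^♯`. -/
def BP (g : ℝ × ℝ → ℂ) (z : ℂ) : ℂ :=
  ∫ θ in (0:ℝ)..(2 * π), g (wrap (betam z θ), alpham z θ)

/-- The weighted backprojection operator `I₀^♯ μ^{-2γ-1}`, where `μ(β, α) = cos α`. -/
def BPW (γ : ℝ) (g : ℝ × ℝ → ℂ) : ℂ → ℂ :=
  BP fun p => ((Real.cos p.2 ^ (-(2 * γ) - 1) : ℝ) : ℂ) * g p

/-- The rectangle `(0, 2π] × [-π/2, π/2]` modelling the space of lines `∂₊S𝔻`. -/
def Rect : Set (ℝ × ℝ) := Set.Ioc (0:ℝ) (2 * π) ×ˢ Set.Icc (-(π / 2)) (π / 2)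

/-- The measure `μ^{-2γ} dβ dα` on `∂₊S𝔻`, where `μ(β, α) = cos α`. -/
def bdryMeasure (γ : ℝ) : Measure (ℝ × ℝ) :=
  ((volume : Measure (ℝ × ℝ)).restrict Rect).withDensity
    fun p => ENNReal.ofReal (Real.cos p.2 ^ (-(2 * γ)))

/-- The measure `d^γ dz` on the closed unit disk, where `d(z) = 1 - |z|²`. -/
def diskMeasure (γ : ℝ) : Measure ℂ :=
  ((volume : Measure ℂ).restrict (Metric.closedBall 0 1)).withDensity
    fun z => ENNReal.ofReal ((1 - ‖z‖ ^ 2) ^ γ)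

/-- `L n` is the monic orthogonal polynomial of degree `n` on `[-1, 1]` for the weight
`(1 - x²)^(γ + 1/2)`. -/
def IsMonicOrtho (γ : ℝ) (L : ℕ → Polynomial ℝ) : Prop :=
  ∀ n, (L n).Monic ∧ (L n).natDegree = n ∧
    ∀ m, m < n →
      (∫ x in (-1:ℝ)..(1:ℝ), (L n).eval x * x ^ m * (1 - x ^ 2) ^ (γ + 1/2)) = 0

/-- The functions `ψ_{n,k}^γ = μ^{2γ+1} ((-1)^n / 2π) e^{i(n-2k)(β+α)} L_n^γ (sin α)`. -/
def psiF (γ : ℝ) (L : ℕ → Polynomial ℝ) (n : ℕ) (k : ℤ) (p : ℝ × ℝ) : ℂ :=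
  ((Real.cos p.2 ^ (2 * γ + 1) : ℝ) : ℂ) * (((-1 : ℝ) ^ n / (2 * π) : ℝ) : ℂ) *
    Complex.exp (Complex.I * ((n : ℂ) - 2 * (k : ℂ)) * ((p.1 + p.2 : ℝ) : ℂ)) *
    (((L n).eval (Real.sin p.2) : ℝ) : ℂ)

/-- The generalized Zernike polynomials
`G_{n,k}^γ (z) = (1/2π) ∫₀^{2π} e^{i(n-2k)θ} L_n^γ ((i/2)(z̄ e^{iθ} - z e^{-iθ})) dθ`. -/
def GZ (γ : ℝ) (L : ℕ → Polynomial ℝ) (n : ℕ) (k : ℤ) (z : ℂ) : ℂ :=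
  ((1 / (2 * π) : ℝ) : ℂ) * ∫ θ in (0:ℝ)..(2 * π),
    Complex.exp (Complex.I * ((n : ℂ) - 2 * (k : ℂ)) * (θ : ℂ)) *
      Polynomial.aeval
        ((Complex.I / 2) *
          ((starRingEnd ℂ) z * Complex.exp ((θ : ℂ) * Complex.I) -
            z * Complex.exp (-(θ : ℂ) * Complex.I))) (L n)

/-- `L²(𝔻, d^γ dz)`-norm. -/
def dNorm (γ : ℝ) (f : ℂ → ℂ) : ℝ := Real.sqrt (∫ z, ‖f z‖ ^ 2 ∂(diskMeasure γ))

/-- `L²(∂₊S𝔻, μ^{-2γ} dβ dα)`-norm. -/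
def bNorm (γ : ℝ) (g : ℝ × ℝ → ℂ) : ℝ := Real.sqrt (∫ p, ‖g p‖ ^ 2 ∂(bdryMeasure γ))

/-- `G_{n,k}^γ` normalized to unit norm in `L²(𝔻, d^γ dz)`. -/
def Ghat (γ : ℝ) (L : ℕ → Polynomial ℝ) (n : ℕ) (k : ℤ) (z : ℂ) : ℂ :=
  (((dNorm γ (GZ γ L n k))⁻¹ : ℝ) : ℂ) * GZ γ L n k z

/-- `ψ_{n,k}^γ` normalized to unit norm in `L²(∂₊S𝔻, μ^{-2γ} dβ dα)`. -/
def psihat (γ : ℝ) (L : ℕ → Polynomial ℝ) (n : ℕ) (k : ℤ) (p : ℝ × ℝ) : ℂ :=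
  (((bNorm γ (psiF γ L n k))⁻¹ : ℝ) : ℂ) * psiF γ L n k p

/-- The squared singular values `(σ_{n,k}^γ)²`. -/
def sigSq (γ : ℝ) (n k : ℕ) : ℝ :=
  2 ^ (2 * γ + 2) * π * (n.choose k) *
    Real.Gamma ((n : ℝ) - k + γ + 1) * Real.Gamma ((k : ℝ) + γ + 1) /
      Real.Gamma ((n : ℝ) + 2 * γ + 2)

/-- The singular values `σ_{n,k}^γ ≥ 0`. -/
def sig (γ : ℝ) (n k : ℕ) : ℝ := Real.sqrt (sigSq γ n k)

/-- The Beta function `B(x,y) = Γ(x)Γ(y)/Γ(x+y)`. -/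
def betaFn (x y : ℝ) : ℝ := Real.Gamma x * Real.Gamma y / Real.Gamma (x + y)

/-! ## Differential operators -/

/-- Radial derivative `∂_ρ` in polar coordinates `z = ρ e^{iω}`. -/
def dRho (f : ℂ → ℂ) (z : ℂ) : ℂ :=
  deriv (fun r : ℝ => f ((r : ℂ) * Complex.exp ((z.arg : ℂ) * Complex.I))) ‖z‖

/-- Angular derivative `∂_ω` in polar coordinates `z = ρ e^{iω}`. -/
def dOmega (f : ℂ → ℂ) (z : ℂ) : ℂ :=
  deriv (fun w : ℝ => f ((‖z‖ : ℂ) * Complex.exp ((w : ℂ) * Complex.I))) z.arg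

/-- The operator `𝓛_γ = -(1-ρ²)∂_ρ² - (ρ⁻¹ - (3+2γ)ρ)∂_ρ - ρ⁻²∂_ω² + (γ+1)²`. -/
def Lop (γ : ℝ) (f : ℂ → ℂ) (z : ℂ) : ℂ :=
  -(1 - (‖z‖ : ℂ) ^ 2) * dRho (dRho f) z -
    ((‖z‖ : ℂ)⁻¹ - (3 + 2 * (γ : ℂ)) * (‖z‖ : ℂ)) * dRho f z -
    ((‖z‖ : ℂ) ^ 2)⁻¹ * dOmega (dOmega f) z + ((γ : ℂ) + 1) ^ 2 * f z

/-- `∂_β` on `∂₊S𝔻`. -/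
def dBeta (g : ℝ × ℝ → ℂ) (p : ℝ × ℝ) : ℂ := deriv (fun b : ℝ => g (b, p.2)) p.1

/-- `∂_α` on `∂₊S𝔻`. -/
def dAlpha (g : ℝ × ℝ → ℂ) (p : ℝ × ℝ) : ℂ := deriv (fun a : ℝ => g (p.1, a)) p.2

/-- The operator `T = ∂_β - ∂_α`. -/
def Tline (g : ℝ × ℝ → ℂ) (p : ℝ × ℝ) : ℂ := dBeta g p - dAlpha g p

/-- The power `μ^e = (cos α)^e` as a complex-valued function on `∂₊S𝔻`. -/
def muC (e : ℝ) (p : ℝ × ℝ) : ℂ := ((Real.cos p.2 ^ e : ℝ) : ℂ)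

/-- The operator `𝓣_γ = -μ^{2γ} T μ^{-2γ} T + γ²`. -/
def Tgam (γ : ℝ) (g : ℝ × ℝ → ℂ) (p : ℝ × ℝ) : ℂ :=
  -muC (2 * γ) p * Tline (fun q => muC (-(2 * γ)) q * Tline g q) p + (γ : ℂ) ^ 2 * g p

/-! ## Scattering relations and the space `C^∞_{α,+,+}(∂₊S𝔻)` -/

/-- The scattering relation `𝒮(β, α) = (β + π + 2α, π - α)`. -/
def Scat (p : ℝ × ℝ) : ℝ × ℝ := (p.1 + π + 2 * p.2, π - p.2)

/-- The antipodal scattering relation `𝒮_A(β, α) = (β + π + 2α, -α)`. -/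
def ScatA (p : ℝ × ℝ) : ℝ × ℝ := (p.1 + π + 2 * p.2, -p.2)

/-- Membership in `C^∞_{α,+,+}(∂₊S𝔻)`: `f`, given on the strip `ℝ × [-π/2, π/2]` (2π-periodically
in β), has an even extension through the scattering relation which is smooth on all of `∂S𝔻`
(modelled as a doubly 2π-periodic smooth function on `ℝ²` invariant under `𝒮`), and `f` is
invariant under the antipodal scattering relation. -/
def MemCapp (f : ℝ × ℝ → ℂ) : Prop :=
  ∃ F : ℝ × ℝ → ℂ, ContDiff ℝ (⊤ : ℕ∞) F ∧
    (∀ p : ℝ × ℝ, F (p.1 + 2 * π, p.2) = F p) ∧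
    (∀ p : ℝ × ℝ, F (p.1, p.2 + 2 * π) = F p) ∧
    (∀ p : ℝ × ℝ, F (Scat p) = F p) ∧
    (∀ p : ℝ × ℝ, p.2 ∈ Set.Icc (-(π / 2)) (π / 2) → F (ScatA p) = F p) ∧
    (∀ p : ℝ × ℝ, p.2 ∈ Set.Icc (-(π / 2)) (π / 2) → f p = F p)

/-- `C^∞(𝔻)`: smooth up to the boundary of the closed unit disk. -/
def CinfDisk (f : ℂ → ℂ) : Prop := ContDiffOn ℝ (⊤ : ℕ∞) f (Metric.closedBall 0 1)

end

noncomputable section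

theorem contDiff_intervalIntegral_nat {H : Type} [NormedAddCommGroup H] [NormedSpace ℝ H]
    [ProperSpace H] (a b : ℝ) (n : ℕ) : ∀ {E : Type} [NormedAddCommGroup E] [NormedSpace ℝ E]
    {f : H × ℝ → E}, ContDiff ℝ n f → ContDiff ℝ n (fun x => ∫ t in a..b, f (x, t)) := by
  induction n with
  | zero =>
    intro E _ _ f hf
    simp only [Nat.cast_zero, contDiff_zero] at hf ⊢
    exact intervalIntegral.continuous_parametric_intervalIntegral_of_continuous'
      (f := fun x t => f (x, t)) hf a b
  | succ n ih =>
    intro E _ _ f hf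
    set f' : H × ℝ → (H →L[ℝ] E) :=
      fun q => (fderiv ℝ f q).comp (ContinuousLinearMap.inl ℝ H ℝ) with hf'_def
    have hf' : ContDiff ℝ n f' :=
      (hf.fderiv_right (m := n) (by norm_cast)).clm_comp contDiff_const
    have hf'c : Continuous f' := hf'.continuous
    have hdf : Differentiable ℝ f := hf.differentiable (by norm_cast)
    have key : ∀ x, HasFDerivAt (fun x => ∫ t in a..b, f (x, t)) (∫ t in a..b, f' (x, t)) x := by
      intro x₀
      obtain ⟨C, hC⟩ := ((isCompact_closedBall x₀ 1).prod (isCompact_uIcc (a := a) (b := b))).exists_bound_of_continuousOn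
        hf'c.continuousOn
      refine intervalIntegral.hasFDerivAt_integral_of_dominated_of_fderiv_le (bound := fun _ => C)
        (F := fun x t => f (x, t)) (F' := fun x t => f' (x, t))
        (Metric.closedBall_mem_nhds x₀ one_pos) ?_ ?_ ?_ ?_ ?_ ?_
      · refine .of_forall fun x => Continuous.aestronglyMeasurable ?_
        exact hf.continuous.comp (by fun_prop)
      · exact (hf.continuous.comp (by fun_prop : Continuous fun t : ℝ => (x₀, t))).intervalIntegrable _ _
      · exact (hf'c.comp (by fun_prop : Continuous fun t : ℝ => (x₀, t))).aestronglyMeasurable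
      · refine .of_forall fun t ht x hx => hC (x, t) ⟨hx, uIoc_subset_uIcc ht⟩
      · exact intervalIntegrable_const
      · refine .of_forall fun t _ x _ => ?_
        have h1 : HasFDerivAt (fun x : H => (x, t)) (ContinuousLinearMap.inl ℝ H ℝ) x :=
          hasFDerivAt_prodMk_left x t
        exact (hdf (x, t)).hasFDerivAt.comp x h1
    push_cast
    rw [contDiff_succ_iff_fderiv]
    refine ⟨fun x => (key x).differentiableAt, by simp, ?_⟩
    rw [show fderiv ℝ (fun x => ∫ t in a..b, f (x, t)) = fun x => ∫ t in a..b, f' (x, t) from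
      funext fun x => (key x).fderiv]
    exact ih hf'

theorem contDiff_intervalIntegral {H E : Type} [NormedAddCommGroup H] [NormedSpace ℝ H]
    [ProperSpace H] [NormedAddCommGroup E] [NormedSpace ℝ E] (a b : ℝ)
    {f : H × ℝ → E} (hf : ContDiff ℝ (⊤ : ℕ∞) f) :
    ContDiff ℝ (⊤ : ℕ∞) (fun x => ∫ t in a..b, f (x, t)) :=
  contDiff_infty.2 fun n => contDiff_intervalIntegral_nat a b n (contDiff_infty.1 hf n)

/-- The Hadamard lemma in the second variable. -/
theorem exists_contDiff_sub_smul {E : Type} [NormedAddCommGroup E] [NormedSpace ℝ E]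
    [CompleteSpace E] {f : ℝ × ℝ → E} (hf : ContDiff ℝ (⊤ : ℕ∞) f) (a : ℝ)
    (h0 : ∀ b, f (b, a) = 0) :
    ∃ g : ℝ × ℝ → E, ContDiff ℝ (⊤ : ℕ∞) g ∧ ∀ p, f p = (p.2 - a) • g p := by
  set f' : ℝ × ℝ → E := fun q => fderiv ℝ f q (0, 1)
  have hf' : ContDiff ℝ (⊤ : ℕ∞) f' :=
    (hf.fderiv_right (m := (⊤ : ℕ∞)) (by norm_cast)).clm_apply contDiff_const
  have hd : Differentiable ℝ f := hf.differentiable (by simp)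
  refine ⟨fun p => ∫ t in (0 : ℝ)..1, f' (p.1, a + t * (p.2 - a)),
    contDiff_intervalIntegral 0 1
      (f := fun q : (ℝ × ℝ) × ℝ => f' (q.1.1, a + q.2 * (q.1.2 - a)))
      (hf'.comp (by fun_prop)), fun p => ?_⟩
  have hder : ∀ t : ℝ, HasDerivAt (fun t : ℝ => f (p.1, a + t * (p.2 - a)))
      ((p.2 - a) • f' (p.1, a + t * (p.2 - a))) t := by
    intro t
    have h2 : HasDerivAt (fun t : ℝ => (p.1, a + t * (p.2 - a))) ((p.2 - a) • ((0 : ℝ), (1 : ℝ))) t := by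
      simpa using (hasDerivAt_const t p.1).prodMk
        (((hasDerivAt_id t).mul_const (p.2 - a)).const_add a)
    have h3 := (hd (p.1, a + t * (p.2 - a))).hasFDerivAt.comp_hasDerivAt t h2
    rwa [map_smul] at h3
  have hcont : Continuous fun t : ℝ => (p.2 - a) • f' (p.1, a + t * (p.2 - a)) :=
    (hf'.continuous.comp (by fun_prop)).const_smul _
  have := intervalIntegral.integral_eq_sub_of_hasDerivAt (fun t _ => hder t)
    (hcont.intervalIntegrable 0 1)
  rw [intervalIntegral.integral_smul] at this
  simpa [h0] using this.symm

theorem fderiv_sub_smul_apply {E : Type} [NormedAddCommGroup E] [NormedSpace ℝ E] {f u : ℝ × ℝ → E}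
    {a : ℝ} (hu : ContDiff ℝ (⊤ : ℕ∞) u) (hfu : ∀ q, f q = (q.2 - a) • u q) (q : ℝ × ℝ)
    (hq : q.2 = a) : fderiv ℝ f q (0, 1) = u q := by
  have hud : HasFDerivAt u (fderiv ℝ u q) q := (hu.differentiable (by simp) q).hasFDerivAt
  have h1 : HasFDerivAt (fun q : ℝ × ℝ => q.2 - a) (ContinuousLinearMap.snd ℝ ℝ ℝ) q :=
    hasFDerivAt_snd.sub_const _
  obtain rfl : f = (fun q : ℝ × ℝ => q.2 - a) • u := funext hfu
  rw [(h1.smul hud).fderiv]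
  simp [hq]

theorem exists_contDiff_cos_smul {E : Type} [NormedAddCommGroup E] [NormedSpace ℝ E]
    [CompleteSpace E] {f : ℝ × ℝ → E} (hf : ContDiff ℝ (⊤ : ℕ∞) f)
    (h0 : ∀ b a, Real.cos a = 0 → f (b, a) = 0) :
    ∃ g : ℝ × ℝ → E, ContDiff ℝ (⊤ : ℕ∞) g ∧ ∀ p, f p = Real.cos p.2 • g p := by
  set g : ℝ × ℝ → E := fun p => if Real.cos p.2 = 0 then
    (-Real.sin p.2)⁻¹ • fderiv ℝ f p (0, 1) else (Real.cos p.2)⁻¹ • f p with hg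
  refine ⟨g, contDiff_iff_contDiffAt.2 fun p => ?_, fun p => ?_⟩
  · have hcos : ContDiff ℝ (⊤ : ℕ∞) fun p : ℝ × ℝ => Real.cos p.2 := by fun_prop
    by_cases hp : Real.cos p.2 = 0
    · obtain ⟨u, hu, hfu⟩ := exists_contDiff_sub_smul hf p.2 (fun b => h0 b _ hp)
      obtain ⟨c, hc, hcc⟩ := exists_contDiff_sub_smul hcos p.2 (fun b => hp)
      have hc_eq : ∀ q : ℝ × ℝ, q.2 = p.2 → c q = -Real.sin p.2 := by
        intro q hq
        rw [← fderiv_sub_smul_apply hc hcc q hq]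
        have : HasFDerivAt (fun q : ℝ × ℝ => Real.cos q.2) _ q := (hasFDerivAt_snd).cos
        rw [this.fderiv]
        simp [hq]
      have hsin : Real.sin p.2 ≠ 0 := by
        intro h
        have := Real.sin_sq_add_cos_sq p.2
        simp [h, hp] at this
      have hcp : c p ≠ 0 := by
        rw [hc_eq p rfl]
        simpa using hsin
      have hev : g =ᶠ[nhds p] fun q => (c q)⁻¹ • u q := by
        filter_upwards [hc.continuous.continuousAt.eventually_ne hcp] with q hq
        by_cases hqp : q.2 = p.2
        · simp only [hg, hqp, hp, if_true]
          rw [fderiv_sub_smul_apply hu hfu q hqp, hc_eq q hqp]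
        · have hne : q.2 - p.2 ≠ 0 := sub_ne_zero.2 hqp
          have : Real.cos q.2 ≠ 0 := by
            rw [hcc q]
            exact smul_ne_zero hne hq
          simp only [hg, if_neg this]
          rw [hcc q, hfu q, smul_smul, smul_eq_mul]
          congr 1
          field_simp
      exact ((hc.contDiffAt.inv hcp).smul hu.contDiffAt).congr_of_eventuallyEq hev
    · have hev : g =ᶠ[nhds p] fun q => (Real.cos q.2)⁻¹ • f q := by
        filter_upwards [hcos.continuous.continuousAt.eventually_ne hp] with q hq
        simp only [hg, if_neg hq]
      exact ((hcos.contDiffAt.inv hp).smul hf.contDiffAt).congr_of_eventuallyEq hev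
  · by_cases hp : Real.cos p.2 = 0
    · rw [hp, zero_smul]
      exact h0 p.1 p.2 hp
    · simp only [hg, if_neg hp, smul_smul]
      rw [mul_inv_cancel₀ hp, one_smul]

theorem dBeta_eq_fderiv {F : ℝ × ℝ → ℂ} {p : ℝ × ℝ} (hF : DifferentiableAt ℝ F p) :
    dBeta F p = fderiv ℝ F p (1, 0) :=
  (HasFDerivAt.comp_hasDerivAt (f := fun b : ℝ => (b, p.2)) p.1 hF.hasFDerivAt
    ((hasDerivAt_id p.1).prodMk (hasDerivAt_const p.1 p.2))).deriv

theorem dAlpha_eq_fderiv {F : ℝ × ℝ → ℂ} {p : ℝ × ℝ} (hF : DifferentiableAt ℝ F p) :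
    dAlpha F p = fderiv ℝ F p (0, 1) :=
  (HasFDerivAt.comp_hasDerivAt (f := fun a : ℝ => (p.1, a)) p.2 hF.hasFDerivAt
    ((hasDerivAt_const p.2 p.1).prodMk (hasDerivAt_id p.2))).deriv

theorem Tline_eq_fderiv {F : ℝ × ℝ → ℂ} {p : ℝ × ℝ} (hF : DifferentiableAt ℝ F p) :
    Tline F p = fderiv ℝ F p (1, -1) := by
  rw [Tline, dBeta_eq_fderiv hF, dAlpha_eq_fderiv hF, ← map_sub]
  simp

theorem ContDiff.Tline {F : ℝ × ℝ → ℂ} (hF : ContDiff ℝ (⊤ : ℕ∞) F) :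
    ContDiff ℝ (⊤ : ℕ∞) (Tline F) := by
  rw [show _root_.Tline F = fun p => fderiv ℝ F p (1, -1) from
    funext fun p => Tline_eq_fderiv (hF.differentiable (by simp) p)]
  exact (hF.fderiv_right (m := (⊤ : ℕ∞)) (by norm_cast)).clm_apply contDiff_const

/-- For differentiable functions, `T` is the derivative along the direction `(1, -1)`. -/
theorem hasDerivAt_Tline {F : ℝ × ℝ → ℂ} {p : ℝ × ℝ} (hF : DifferentiableAt ℝ F p) :
    HasDerivAt (fun t : ℝ => F (p.1 + t, p.2 - t)) (Tline F p) 0 := by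
  rw [Tline_eq_fderiv hF]
  have h : HasDerivAt (fun t : ℝ => (p.1 + t, p.2 - t)) ((1 : ℝ), (-1 : ℝ)) 0 :=
    ((hasDerivAt_id (0 : ℝ)).const_add p.1).prodMk ((hasDerivAt_id (0 : ℝ)).const_sub p.2)
  have hF' : HasFDerivAt F (fderiv ℝ F p) (p.1 + 0, p.2 - 0) := by simpa using hF.hasFDerivAt
  exact HasFDerivAt.comp_hasDerivAt (f := fun t : ℝ => (p.1 + t, p.2 - t)) 0 hF' h

theorem Tline_eq_of_hasDerivAt {F : ℝ × ℝ → ℂ} {p : ℝ × ℝ} {c : ℂ} (hF : DifferentiableAt ℝ F p)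
    (h : HasDerivAt (fun t : ℝ => F (p.1 + t, p.2 - t)) c 0) : Tline F p = c :=
  (hasDerivAt_Tline hF).unique h

theorem Tline_mul {f g : ℝ × ℝ → ℂ} {p : ℝ × ℝ} (hf : DifferentiableAt ℝ f p)
    (hg : DifferentiableAt ℝ g p) :
    Tline (fun q => f q * g q) p = Tline f p * g p + f p * Tline g p :=
  Tline_eq_of_hasDerivAt (hf.mul hg)
    (((hasDerivAt_Tline hf).mul (hasDerivAt_Tline hg)).congr_deriv (by simp))

theorem Tline_add {f g : ℝ × ℝ → ℂ} {p : ℝ × ℝ} (hf : DifferentiableAt ℝ f p)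
    (hg : DifferentiableAt ℝ g p) :
    Tline (fun q => f q + g q) p = Tline f p + Tline g p :=
  Tline_eq_of_hasDerivAt (hf.add hg) ((hasDerivAt_Tline hf).add (hasDerivAt_Tline hg))

theorem Tline_neg {f : ℝ × ℝ → ℂ} {p : ℝ × ℝ} (hf : DifferentiableAt ℝ f p) :
    Tline (fun q => -f q) p = -Tline f p :=
  Tline_eq_of_hasDerivAt hf.neg (hasDerivAt_Tline hf).neg

theorem Tline_const_mul {f : ℝ × ℝ → ℂ} {p : ℝ × ℝ} (c : ℂ) (hf : DifferentiableAt ℝ f p) :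
    Tline (fun q => c * f q) p = c * Tline f p :=
  Tline_eq_of_hasDerivAt (hf.const_mul c) ((hasDerivAt_Tline hf).const_mul c)

theorem Tline_conj {f : ℝ × ℝ → ℂ} {p : ℝ × ℝ} (hf : DifferentiableAt ℝ f p) :
    Tline (fun q => (starRingEnd ℂ) (f q)) p = (starRingEnd ℂ) (Tline f p) :=
  Tline_eq_of_hasDerivAt (Complex.conjCLE.differentiableAt.comp p hf)
    (Complex.conjCLE.toContinuousLinearMap.hasFDerivAt.comp_hasDerivAt 0 (hasDerivAt_Tline hf))

theorem Tline_cos (p : ℝ × ℝ) :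
    Tline (fun q => ((Real.cos q.2 : ℝ) : ℂ)) p = ((Real.sin p.2 : ℝ) : ℂ) := by
  refine Tline_eq_of_hasDerivAt (by fun_prop) ?_
  have h : HasDerivAt (fun t : ℝ => Real.cos (p.2 - t)) (Real.sin p.2) 0 := by
    simpa using ((hasDerivAt_id (0 : ℝ)).const_sub p.2).cos
  exact h.ofReal_comp

theorem Tline_sin (p : ℝ × ℝ) :
    Tline (fun q => ((Real.sin q.2 : ℝ) : ℂ)) p = -((Real.cos p.2 : ℝ) : ℂ) := by
  refine Tline_eq_of_hasDerivAt (by fun_prop) ?_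
  have h : HasDerivAt (fun t : ℝ => Real.sin (p.2 - t)) (-Real.cos p.2) 0 := by
    simpa using ((hasDerivAt_id (0 : ℝ)).const_sub p.2).sin
  simpa using h.ofReal_comp

theorem differentiableAt_muC {e : ℝ} {p : ℝ × ℝ} (hp : Real.cos p.2 ≠ 0) :
    DifferentiableAt ℝ (muC e) p := by
  have : DifferentiableAt ℝ (fun q : ℝ × ℝ => Real.cos q.2 ^ e) p :=
    DifferentiableAt.rpow_const (by fun_prop) (Or.inl hp)
  exact Complex.ofRealCLM.differentiableAt.comp p this

theorem Tline_muC {e : ℝ} {p : ℝ × ℝ} (hp : Real.cos p.2 ≠ 0) :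
    Tline (muC e) p = e * muC (e - 1) p * ((Real.sin p.2 : ℝ) : ℂ) := by
  refine Tline_eq_of_hasDerivAt (differentiableAt_muC hp) ?_
  have h : HasDerivAt (fun t : ℝ => Real.cos (p.2 - t)) (Real.sin p.2) 0 := by
    simpa using ((hasDerivAt_id (0 : ℝ)).const_sub p.2).cos
  have := (h.rpow_const (p := e) (Or.inl (by simpa using hp))).ofReal_comp
  refine this.congr_deriv ?_
  simp only [muC, sub_zero]
  push_cast
  ring

theorem muC_mul {a b : ℝ} {p : ℝ × ℝ} (hp : 0 < Real.cos p.2) :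
    muC a p * muC b p = muC (a + b) p := by
  simp only [muC]
  rw [Real.rpow_add hp]
  push_cast
  rfl

theorem muC_mul_cos {a : ℝ} {p : ℝ × ℝ} (hp : 0 < Real.cos p.2) :
    muC a p * ((Real.cos p.2 : ℝ) : ℂ) = muC (a + 1) p := by
  simp only [muC]
  rw [Real.rpow_add_one hp.ne']
  push_cast
  rfl

theorem Tline_congr_strip {f g : ℝ × ℝ → ℂ}
    (h : ∀ q : ℝ × ℝ, q.2 ∈ Ioo (-(π / 2)) (π / 2) → f q = g q) {p : ℝ × ℝ}
    (hp : p.2 ∈ Ioo (-(π / 2)) (π / 2)) : Tline f p = Tline g p := by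
  have h1 : (fun b : ℝ => f (b, p.2)) = fun b => g (b, p.2) := funext fun b => h _ hp
  have h2 : (fun a : ℝ => f (p.1, a)) =ᶠ[nhds p.2] fun a => g (p.1, a) := by
    filter_upwards [isOpen_Ioo.mem_nhds hp] with a ha using h _ ha
  simp only [Tline, dBeta, dAlpha]
  rw [h1, h2.deriv_eq]

theorem eq_of_eqOn_strip {f g : ℝ × ℝ → ℂ} (hf : Continuous f) (hg : Continuous g)
    (h : ∀ q : ℝ × ℝ, q.2 ∈ Ioo (-(π / 2)) (π / 2) → f q = g q) {p : ℝ × ℝ}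
    (hp : p.2 ∈ Icc (-(π / 2)) (π / 2)) : f p = g p := by
  have h1 : EqOn f g (univ ×ˢ Ioo (-(π / 2)) (π / 2)) := fun q hq => h q hq.2
  refine h1.closure hf hg ?_
  rw [closure_prod_eq, closure_Ioo (by linarith [Real.pi_pos])]
  exact ⟨by simp, hp⟩

theorem Tline_comp_of_line {f : ℝ × ℝ → ℂ} (hf : Differentiable ℝ f) {φ : ℝ × ℝ → ℝ × ℝ}
    (hφ : Differentiable ℝ φ) {p : ℝ × ℝ}
    (hline : ∀ t : ℝ, φ (p.1 + t, p.2 - t) = ((φ p).1 - t, (φ p).2 + t)) :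
    Tline (fun q => f (φ q)) p = -Tline f (φ p) := by
  refine Tline_eq_of_hasDerivAt (hf.comp hφ p) ?_
  have h := hasDerivAt_Tline (hf (φ p))
  rw [← neg_zero (G := ℝ)] at h
  have h2 := h.scomp (0 : ℝ) (hasDerivAt_neg (0 : ℝ))
  simp only [hline]
  simpa [Function.comp_def, sub_eq_add_neg] using h2

theorem Tline_comp_Scat {f : ℝ × ℝ → ℂ} (hf : Differentiable ℝ f) (p : ℝ × ℝ) :
    Tline (fun q => f (Scat q)) p = -Tline f (Scat p) := by
  refine Tline_comp_of_line hf (by unfold Scat; fun_prop) fun t => ?_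
  simp only [Scat, Prod.mk.injEq]
  constructor <;> ring

theorem Tline_comp_ScatA {f : ℝ × ℝ → ℂ} (hf : Differentiable ℝ f) (p : ℝ × ℝ) :
    Tline (fun q => f (ScatA q)) p = -Tline f (ScatA p) := by
  refine Tline_comp_of_line hf (by unfold ScatA; fun_prop) fun t => ?_
  simp only [ScatA, Prod.mk.injEq]
  constructor <;> ring

theorem Tline_comp_add (f : ℝ × ℝ → ℂ) (a b : ℝ) (p : ℝ × ℝ) :
    Tline (fun q => f (q.1 + a, q.2 + b)) p = Tline f (p.1 + a, p.2 + b) := by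
  simp only [Tline, dBeta, dAlpha]
  rw [deriv_comp_add_const (fun x => f (x, p.2 + b)), deriv_comp_add_const (fun x => f (p.1 + a, x))]

theorem eq_zero_of_cos_mul_eq_zero {H : ℝ × ℝ → ℂ} (hH : Differentiable ℝ H)
    (h : ∀ p : ℝ × ℝ, ((Real.cos p.2 : ℝ) : ℂ) * H p = 0) (p : ℝ × ℝ) : H p = 0 := by
  have h1 := Tline_mul (f := fun q : ℝ × ℝ => ((Real.cos q.2 : ℝ) : ℂ)) (p := p)
    (by fun_prop) (hH p)
  rw [Tline_cos, funext h] at h1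
  have h0 : Tline (fun _ => (0 : ℂ)) p = 0 := by simp [Tline, dBeta, dAlpha]
  rw [h0] at h1
  by_cases hc : Real.cos p.2 = 0
  · have hs : Real.sin p.2 ≠ 0 := by
      intro hs
      simpa [hs, hc] using Real.sin_sq_add_cos_sq p.2
    have : ((Real.sin p.2 : ℝ) : ℂ) * H p = 0 := by simpa [hc] using h1.symm
    exact (mul_eq_zero.1 this).resolve_left (by exact_mod_cast hs)
  · exact (mul_eq_zero.1 (h p)).resolve_left (by exact_mod_cast hc)

/-- For `h ∈ C^∞_{α,+,+}`, the even extension `F` of `h` and the smooth quotient `G = T F / μ`. -/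
structure IsExtension (h F G : ℝ × ℝ → ℂ) : Prop where
  contDiff_left : ContDiff ℝ (⊤ : ℕ∞) F
  contDiff_right : ContDiff ℝ (⊤ : ℕ∞) G
  eq_left : ∀ p : ℝ × ℝ, p.2 ∈ Icc (-(π / 2)) (π / 2) → h p = F p
  Tline_left : ∀ p : ℝ × ℝ, Tline F p = ((Real.cos p.2 : ℝ) : ℂ) * G p
  periodic_left : ∀ p : ℝ × ℝ, F (p.1 + 2 * π, p.2) = F p
  periodic_right : ∀ p : ℝ × ℝ, G (p.1 + 2 * π, p.2) = G p
  periodic_left' : ∀ p : ℝ × ℝ, F (p.1, p.2 + 2 * π) = F p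
  periodic_right' : ∀ p : ℝ × ℝ, G (p.1, p.2 + 2 * π) = G p
  scat_left : ∀ p : ℝ × ℝ, F (Scat p) = F p
  scat_right : ∀ p : ℝ × ℝ, G (Scat p) = G p
  scatA_left : ∀ p : ℝ × ℝ, p.2 ∈ Icc (-(π / 2)) (π / 2) → F (ScatA p) = F p
  scatA_right : ∀ p : ℝ × ℝ, p.2 ∈ Ioo (-(π / 2)) (π / 2) → G (ScatA p) = -G p

theorem Tline_periodic {F : ℝ × ℝ → ℂ} (h : ∀ p : ℝ × ℝ, F (p.1 + 2 * π, p.2) = F p)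
    (p : ℝ × ℝ) : Tline F (p.1 + 2 * π, p.2) = Tline F p := by
  have h1 := Tline_comp_add F (2 * π) 0 p
  simp only [add_zero] at h1
  rw [← h1, funext h]

theorem Tline_periodic' {F : ℝ × ℝ → ℂ} (h : ∀ p : ℝ × ℝ, F (p.1, p.2 + 2 * π) = F p)
    (p : ℝ × ℝ) : Tline F (p.1, p.2 + 2 * π) = Tline F p := by
  have h1 := Tline_comp_add F 0 (2 * π) p
  simp only [add_zero] at h1
  rw [← h1, funext h]

theorem eq_zero_of_odd_Scat {H : ℝ × ℝ → ℂ} (h1 : ∀ p : ℝ × ℝ, H (p.1 + 2 * π, p.2) = H p)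
    (h2 : ∀ p : ℝ × ℝ, H (p.1, p.2 + 2 * π) = H p) (h3 : ∀ p, H (Scat p) = -H p) (b a : ℝ)
    (ha : Real.cos a = 0) : H (b, a) = 0 := by
  obtain ⟨k, rfl⟩ := Real.cos_eq_zero_iff.1 ha
  set a : ℝ := (2 * k + 1) * π / 2 with ha_def
  have e : Scat (b, a) = (b + ((k + 1 : ℤ) : ℝ) * (2 * π), a + ((-k : ℤ) : ℝ) * (2 * π)) := by
    simp only [Scat, ha_def, Prod.mk.injEq]
    push_cast
    constructor <;> ring
  have p1 : ∀ a, Function.Periodic (fun x => H (x, a)) (2 * π) := fun a x => h1 (x, a)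
  have p2 : ∀ b, Function.Periodic (fun x => H (b, x)) (2 * π) := fun b x => h2 (b, x)
  have h4 := h3 (b, a)
  have h5 := (p1 (a + ((-k : ℤ) : ℝ) * (2 * π))).int_mul (k + 1) b
  have h6 := (p2 b).int_mul (-k) a
  rw [e, h5, h6] at h4
  exact self_eq_neg.1 h4

theorem cos_pos_of_mem_strip {p : ℝ × ℝ} (hp : p.2 ∈ Ioo (-(π / 2)) (π / 2)) :
    0 < Real.cos p.2 := Real.cos_pos_of_mem_Ioo hp

theorem eq_of_cos_mul_eq {f g : ℝ × ℝ → ℂ} (hf : Differentiable ℝ f) (hg : Differentiable ℝ g)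
    (h : ∀ p : ℝ × ℝ, ((Real.cos p.2 : ℝ) : ℂ) * f p = ((Real.cos p.2 : ℝ) : ℂ) * g p)
    (p : ℝ × ℝ) : f p = g p :=
  sub_eq_zero.1 (eq_zero_of_cos_mul_eq_zero (hf.sub hg)
    (fun p => by simp only [Pi.sub_apply, mul_sub, h p, sub_self]) p)

theorem MemCapp.exists_isExtension {h : ℝ × ℝ → ℂ} (hh : MemCapp h) :
    ∃ F G, IsExtension h F G := by
  obtain ⟨F, hF, h1, h2, h3, h4, h5⟩ := hh
  have hFd : Differentiable ℝ F := hF.differentiable (by simp)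
  have hodd : ∀ p, Tline F (Scat p) = -Tline F p := fun p => by
    rw [← neg_eq_iff_eq_neg, ← Tline_comp_Scat hFd, funext h3]
  obtain ⟨G, hG, hTG⟩ := exists_contDiff_cos_smul hF.Tline
    (eq_zero_of_odd_Scat (Tline_periodic h1) (Tline_periodic' h2) hodd)
  have hGd : Differentiable ℝ G := hG.differentiable (by simp)
  simp only [Complex.real_smul] at hTG
  refine ⟨F, G, hF, hG, h5, hTG, h1, ?_, h2, ?_, h3, ?_, h4, ?_⟩
  · refine eq_of_cos_mul_eq (hGd.comp (by fun_prop)) hGd fun p => ?_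
    rw [← hTG, ← Tline_periodic h1, hTG]
  · refine eq_of_cos_mul_eq (hGd.comp (by fun_prop)) hGd fun p => ?_
    rw [← hTG, ← Tline_periodic' h2, hTG, Real.cos_add_two_pi]
  · refine eq_of_cos_mul_eq (hGd.comp (by unfold Scat; fun_prop)) hGd fun p => ?_
    rw [← hTG, ← neg_eq_iff_eq_neg.2 (hodd p), hTG]
    simp [Scat]
  · intro p hp
    have hc : Tline F (ScatA p) = -Tline F p := by
      rw [← neg_eq_iff_eq_neg, ← Tline_comp_ScatA hFd]
      exact Tline_congr_strip (fun q hq => h4 q (Ioo_subset_Icc_self hq)) hp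
    rw [hTG, hTG, ← mul_neg] at hc
    have hne : ((Real.cos p.2 : ℝ) : ℂ) ≠ 0 := by exact_mod_cast (cos_pos_of_mem_strip hp).ne'
    refine mul_left_cancel₀ hne ?_
    simpa [ScatA] using hc

/-- The function `h'` with `𝓣_γ (μ^{2γ+1} h) = μ^{2γ+1} h'`, in terms of `F` and `G = T F / μ`. -/
def reducedTgam (γ : ℝ) (F G : ℝ × ℝ → ℂ) (p : ℝ × ℝ) : ℂ :=
  ((γ : ℂ) + 1) ^ 2 * F p - (((Real.cos p.2 : ℝ) : ℂ) * Tline G p +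
    (2 * (γ : ℂ) + 3) * (((Real.sin p.2 : ℝ) : ℂ) * G p))

theorem IsExtension.memCapp_reducedTgam {h F G : ℝ × ℝ → ℂ} (H : IsExtension h F G) (γ : ℝ) :
    MemCapp (reducedTgam γ F G) := by
  have hGd : Differentiable ℝ G := H.contDiff_right.differentiable (by simp)
  have hF := H.contDiff_left
  have hG := H.contDiff_right
  have hTG := hG.Tline
  have hcos : ContDiff ℝ (⊤ : ℕ∞) fun p : ℝ × ℝ => ((Real.cos p.2 : ℝ) : ℂ) :=
    Complex.ofRealCLM.contDiff.comp (Real.contDiff_cos.comp contDiff_snd)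
  have hsin : ContDiff ℝ (⊤ : ℕ∞) fun p : ℝ × ℝ => ((Real.sin p.2 : ℝ) : ℂ) :=
    Complex.ofRealCLM.contDiff.comp (Real.contDiff_sin.comp contDiff_snd)
  have hR : ContDiff ℝ (⊤ : ℕ∞) (reducedTgam γ F G) :=
    (contDiff_const.mul hF).sub ((hcos.mul hTG).add (contDiff_const.mul (hsin.mul hG)))
  refine ⟨reducedTgam γ F G, hR, fun p => ?_, fun p => ?_, fun p => ?_, fun p hp => ?_,
    fun _ _ => rfl⟩
  · simp only [reducedTgam]
    rw [H.periodic_left, H.periodic_right, Tline_periodic H.periodic_right]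
  · simp only [reducedTgam]
    rw [H.periodic_left', H.periodic_right', Tline_periodic' H.periodic_right',
      Real.cos_add_two_pi, Real.sin_add_two_pi]
  · have : Tline G (Scat p) = -Tline G p := by
      rw [← neg_eq_iff_eq_neg, ← Tline_comp_Scat hGd, funext H.scat_right]
    simp only [reducedTgam]
    rw [H.scat_left, H.scat_right, this]
    simp [Scat]
  · refine eq_of_eqOn_strip (f := fun p => reducedTgam γ F G (ScatA p))
      (hR.continuous.comp (by unfold ScatA; fun_prop)) hR.continuous (fun q hq => ?_) hp
    have : Tline G (ScatA q) = Tline G q := by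
      have h1 := Tline_comp_ScatA hGd q
      rw [Tline_congr_strip H.scatA_right hq, Tline_neg (hGd q)] at h1
      exact (neg_injective h1).symm
    simp only [reducedTgam]
    rw [H.scatA_left q (Ioo_subset_Icc_self hq), H.scatA_right q hq, this]
    simp [ScatA]

theorem IsExtension.Tgam_eq {h F G : ℝ × ℝ → ℂ} (H : IsExtension h F G) (γ : ℝ) {p : ℝ × ℝ}
    (hp : p.2 ∈ Ioo (-(π / 2)) (π / 2)) :
    Tgam γ (fun q => muC (2 * γ + 1) q * h q) p =
      muC (2 * γ + 1) p * reducedTgam γ F G p := by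
  have hFd : Differentiable ℝ F := H.contDiff_left.differentiable (by simp)
  have hGd : Differentiable ℝ G := H.contDiff_right.differentiable (by simp)
  have hcd : Differentiable ℝ fun p : ℝ × ℝ => ((Real.cos p.2 : ℝ) : ℂ) := by fun_prop
  have hsd : Differentiable ℝ fun p : ℝ × ℝ => ((Real.sin p.2 : ℝ) : ℂ) := by fun_prop
  have inner : ∀ q : ℝ × ℝ, q.2 ∈ Ioo (-(π / 2)) (π / 2) →
      muC (-(2 * γ)) q * Tline (fun q => muC (2 * γ + 1) q * h q) q =
        (2 * (γ : ℂ) + 1) * (((Real.sin q.2 : ℝ) : ℂ) * F q) +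
          ((Real.cos q.2 : ℝ) : ℂ) * (((Real.cos q.2 : ℝ) : ℂ) * G q) := by
    intro q hq
    have hc := cos_pos_of_mem_strip hq
    rw [Tline_congr_strip (g := fun q => muC (2 * γ + 1) q * F q)
      (fun q hq => by rw [H.eq_left q (Ioo_subset_Icc_self hq)]) hq,
      Tline_mul (differentiableAt_muC hc.ne') (hFd q), Tline_muC hc.ne', H.Tline_left]
    have e1 : muC (-(2 * γ)) q * muC (2 * γ + 1 - 1) q = 1 := by
      rw [muC_mul hc]; simp [muC]
    have e2 : muC (-(2 * γ)) q * muC (2 * γ + 1) q = ((Real.cos q.2 : ℝ) : ℂ) := by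
      rw [muC_mul hc]; simp [muC]
    push_cast at e2 ⊢
    linear_combination (2 * (γ : ℂ) + 1) * Complex.sin q.2 * F q * e1 +
      Complex.cos q.2 * G q * e2
  have hc := cos_pos_of_mem_strip hp
  have hsF : Differentiable ℝ fun q : ℝ × ℝ => ((Real.sin q.2 : ℝ) : ℂ) * F q := hsd.mul hFd
  have hcG : Differentiable ℝ fun q : ℝ × ℝ => ((Real.cos q.2 : ℝ) : ℂ) * G q := hcd.mul hGd
  have hccG : Differentiable ℝ fun q : ℝ × ℝ =>
    ((Real.cos q.2 : ℝ) : ℂ) * (((Real.cos q.2 : ℝ) : ℂ) * G q) := hcd.mul hcG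
  rw [Tgam, Tline_congr_strip inner hp, Tline_add ((hsF p).const_mul _) (hccG p),
    Tline_const_mul _ (hsF p), Tline_mul (hsd p) (hFd p), Tline_mul (hcd p) (hcG p), Tline_mul (hcd p) (hGd p), Tline_cos, Tline_sin,
    H.Tline_left, H.eq_left p (Ioo_subset_Icc_self hp), ← muC_mul_cos hc, reducedTgam]
  ring

theorem continuous_muC {e : ℝ} (he : 0 ≤ e) : Continuous (muC e) := by
  have : Continuous fun p : ℝ × ℝ => Real.cos p.2 ^ e :=
    (Real.continuous_cos.comp continuous_snd).rpow_const fun _ => Or.inr he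
  exact Complex.continuous_ofReal.comp this

theorem integrableOn_Rect {f : ℝ × ℝ → ℂ} (hf : Continuous f) : IntegrableOn f Rect := by
  have h : IntegrableOn f (Icc (0 : ℝ) (2 * π) ×ˢ Icc (-(π / 2)) (π / 2)) :=
    hf.continuousOn.integrableOn_compact (isCompact_Icc.prod isCompact_Icc)
  exact h.mono_set (prod_mono Ioc_subset_Icc_self le_rfl)

theorem measurableSet_Rect : MeasurableSet Rect := measurableSet_Ioc.prod measurableSet_Icc

theorem setIntegral_Rect {f : ℝ × ℝ → ℂ} (hf : Continuous f) :
    ∫ p in Rect, f p = ∫ b in (0 : ℝ)..(2 * π), ∫ a in (-(π / 2))..(π / 2), f (b, a) := by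
  rw [intervalIntegral.integral_of_le (by positivity)]
  simp_rw [intervalIntegral.integral_of_le (show -(π / 2) ≤ π / 2 by linarith [Real.pi_pos])]
  have h : ∀ b, ∫ a in Ioc (-(π / 2)) (π / 2), f (b, a) =
      ∫ a in Icc (-(π / 2)) (π / 2), f (b, a) := fun b => integral_Icc_eq_integral_Ioc.symm
  simp_rw [h]
  exact setIntegral_prod f (integrableOn_Rect hf)

theorem setIntegral_Rect_symm {f : ℝ × ℝ → ℂ} (hf : Continuous f) :
    ∫ p in Rect, f p = ∫ a in (-(π / 2))..(π / 2), ∫ b in (0 : ℝ)..(2 * π), f (b, a) := by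
  rw [setIntegral_Rect hf]
  refine intervalIntegral_intervalIntegral_swap (F := fun b a => f (b, a)) ?_
  have h : IntegrableOn f (uIcc (0 : ℝ) (2 * π) ×ˢ uIcc (-(π / 2)) (π / 2)) :=
    hf.continuousOn.integrableOn_compact (isCompact_uIcc.prod isCompact_uIcc)
  exact h.mono_set (prod_mono uIoc_subset_uIcc uIoc_subset_uIcc)

theorem ae_mem_strip_of_mem_Rect :
    ∀ᵐ p : ℝ × ℝ, p ∈ Rect → p.2 ∈ Ioo (-(π / 2)) (π / 2) := by
  have h : ∀ c : ℝ, ∀ᵐ p : ℝ × ℝ, p.2 ≠ c := fun c =>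
    Measure.quasiMeasurePreserving_snd.ae (Measure.ae_ne volume c)
  filter_upwards [h (-(π / 2)), h (π / 2)] with p h1 h2 hp
  exact ⟨lt_of_le_of_ne hp.2.1 h1.symm, lt_of_le_of_ne hp.2.2 h2⟩

/-- The integral over `∂₊S𝔻` of `T (μ^e W)`, written out, vanishes. -/
theorem setIntegral_Rect_Tline_eq_zero {e : ℝ} (he : 1 < e) {W : ℝ × ℝ → ℂ}
    (hW : ContDiff ℝ (⊤ : ℕ∞) W) (hper : ∀ p : ℝ × ℝ, W (p.1 + 2 * π, p.2) = W p) :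
    ∫ p in Rect, muC (e - 1) p *
      (((Real.cos p.2 : ℝ) : ℂ) * Tline W p + e * (((Real.sin p.2 : ℝ) : ℂ) * W p)) = 0 := by
  have hWd : Differentiable ℝ W := hW.differentiable (by simp)
  have hfd : ∀ v : ℝ × ℝ, Continuous fun p => fderiv ℝ W p v := fun v =>
    ((hW.fderiv_right (m := (⊤ : ℕ∞)) (by norm_cast)).clm_apply contDiff_const).continuous
  have hb : Continuous (dBeta W) := by
    rw [show dBeta W = _ from funext fun p => dBeta_eq_fderiv (hWd p)]
    exact hfd _
  have ha : Continuous (dAlpha W) := by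
    rw [show dAlpha W = _ from funext fun p => dAlpha_eq_fderiv (hWd p)]
    exact hfd _
  have hm := continuous_muC (e := e) (by linarith)
  have hm' := continuous_muC (e := e - 1) (by linarith)
  have hWc := hW.continuous
  have hA : Continuous fun p : ℝ × ℝ => muC e p * dBeta W p := hm.mul hb
  have hB : Continuous fun p : ℝ × ℝ => muC e p * dAlpha W p -
      e * (((Real.sin p.2 : ℝ) : ℂ) * (muC (e - 1) p * W p)) := by fun_prop
  have hA0 : ∫ p in Rect, muC e p * dBeta W p = 0 := by
    rw [setIntegral_Rect_symm hA]
    refine intervalIntegral.integral_zero_ae (.of_forall fun a _ => ?_)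
    have hd : ∀ b : ℝ, HasDerivAt (fun b => muC e (b, a) * W (b, a))
        (muC e (b, a) * dBeta W (b, a)) b := fun b => by
      have h1 : DifferentiableAt ℝ (fun b : ℝ => W (b, a)) b :=
        (hWd (b, a)).comp b (by fun_prop)
      exact h1.hasDerivAt.const_mul (muC e (b, a))
    rw [intervalIntegral.integral_eq_sub_of_hasDerivAt (fun b _ => hd b)
      ((hA.comp (by fun_prop : Continuous fun b : ℝ => (b, a))).intervalIntegrable _ _)]
    have := hper (0, a)
    simp only [zero_add] at this
    simp [this, muC]
  have hB0 : ∫ p in Rect, (muC e p * dAlpha W p -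
      e * (((Real.sin p.2 : ℝ) : ℂ) * (muC (e - 1) p * W p))) = 0 := by
    rw [setIntegral_Rect hB]
    refine intervalIntegral.integral_zero_ae (.of_forall fun b _ => ?_)
    have hd : ∀ a : ℝ, HasDerivAt (fun a => muC e (b, a) * W (b, a))
        (muC e (b, a) * dAlpha W (b, a) -
          e * (((Real.sin a : ℝ) : ℂ) * (muC (e - 1) (b, a) * W (b, a)))) a := fun a => by
      have h1 : DifferentiableAt ℝ (fun a : ℝ => W (b, a)) a :=
        (hWd (b, a)).comp a (by fun_prop)
      have h2 := ((Real.hasDerivAt_cos a).rpow_const (p := e) (Or.inr he.le)).ofReal_comp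
      refine (h2.mul h1.hasDerivAt).congr_deriv ?_
      simp only [muC, dAlpha]
      push_cast
      ring
    rw [intervalIntegral.integral_eq_sub_of_hasDerivAt (fun a _ => hd a)
      ((hB.comp (by fun_prop : Continuous fun a : ℝ => (b, a))).intervalIntegrable _ _)]
    simp [muC, Real.zero_rpow (by linarith : e ≠ 0)]
  rw [← sub_self (0 : ℂ)]
  nth_rw 1 [← hA0]
  rw [← hB0, ← integral_sub (integrableOn_Rect hA) (integrableOn_Rect hB)]
  refine setIntegral_congr_ae measurableSet_Rect ?_
  filter_upwards [ae_mem_strip_of_mem_Rect] with p hp hpR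
  have h := muC_mul_cos (a := e - 1) (cos_pos_of_mem_strip (hp hpR))
  rw [sub_add_cancel] at h
  rw [← h, Tline]
  ring

/-- The bilinear form `⟨T hφ, T hψ⟩ + (γ+1)² ⟨hφ, hψ⟩` represents `𝓣_γ`. -/
theorem setIntegral_Tgam_eq {γ : ℝ} (hγ : -1 < γ) {hφ hψ : ℝ × ℝ → ℂ} (mφ : MemCapp hφ)
    (mψ : MemCapp hψ) :
    (∫ p in Rect, Tgam γ (fun q => muC (2 * γ + 1) q * hφ q) p *
        (starRingEnd ℂ) (muC (2 * γ + 1) p * hψ p) * muC (-(2 * γ)) p)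
      = (∫ p in Rect, Tline hφ p * (starRingEnd ℂ) (Tline hψ p) * muC (2 * γ + 2) p)
        + ((γ : ℂ) + 1) ^ 2 *
          ∫ p in Rect, hφ p * (starRingEnd ℂ) (hψ p) * muC (2 * γ + 2) p := by
  obtain ⟨F, G, H⟩ := mφ.exists_isExtension
  obtain ⟨P, Q, K⟩ := mψ.exists_isExtension
  have hFc := H.contDiff_left.continuous
  have hPc := K.contDiff_left.continuous
  have hTFc := H.contDiff_left.Tline.continuous
  have hTPc := K.contDiff_left.Tline.continuous
  have hGd : Differentiable ℝ G := H.contDiff_right.differentiable (by simp)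
  have hPd : Differentiable ℝ P := K.contDiff_left.differentiable (by simp)
  have hm := continuous_muC (e := 2 * γ + 2) (by linarith)
  have hconj : ContDiff ℝ (⊤ : ℕ∞) fun p => (starRingEnd ℂ) (P p) :=
    Complex.conjCLE.toContinuousLinearMap.contDiff.comp K.contDiff_left
  have hW : ContDiff ℝ (⊤ : ℕ∞) fun p => G p * (starRingEnd ℂ) (P p) :=
    H.contDiff_right.mul hconj
  have hTWc := hW.Tline.continuous
  have hWc := hW.continuous
  have hzero := setIntegral_Rect_Tline_eq_zero (e := 2 * γ + 3) (by linarith) hW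
    (fun p => by rw [H.periodic_right, K.periodic_left])
  rw [show 2 * γ + 3 - 1 = 2 * γ + 2 by ring] at hzero
  have hX : Continuous fun p => Tline F p * (starRingEnd ℂ) (Tline P p) * muC (2 * γ + 2) p :=
    (hTFc.mul (Complex.continuous_conj.comp hTPc)).mul hm
  have hY : Continuous fun p =>
      ((γ : ℂ) + 1) ^ 2 * (F p * (starRingEnd ℂ) (P p) * muC (2 * γ + 2) p) :=
    continuous_const.mul ((hFc.mul (Complex.continuous_conj.comp hPc)).mul hm)
  have hXY : Continuous fun p => Tline F p * (starRingEnd ℂ) (Tline P p) * muC (2 * γ + 2) p +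
      ((γ : ℂ) + 1) ^ 2 * (F p * (starRingEnd ℂ) (P p) * muC (2 * γ + 2) p) := hX.add hY
  have hZ : Continuous fun p : ℝ × ℝ => muC (2 * γ + 2) p *
      (((Real.cos p.2 : ℝ) : ℂ) * Tline (fun p => G p * (starRingEnd ℂ) (P p)) p +
        ((2 * γ + 3 : ℝ) : ℂ) *
          (((Real.sin p.2 : ℝ) : ℂ) * (G p * (starRingEnd ℂ) (P p)))) := by
    fun_prop
  have e1 : ∫ p in Rect, Tline hφ p * (starRingEnd ℂ) (Tline hψ p) * muC (2 * γ + 2) p =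
      ∫ p in Rect, Tline F p * (starRingEnd ℂ) (Tline P p) * muC (2 * γ + 2) p := by
    refine setIntegral_congr_ae measurableSet_Rect ?_
    filter_upwards [ae_mem_strip_of_mem_Rect] with p hp hpR
    rw [Tline_congr_strip (fun q hq => H.eq_left q (Ioo_subset_Icc_self hq)) (hp hpR),
      Tline_congr_strip (fun q hq => K.eq_left q (Ioo_subset_Icc_self hq)) (hp hpR)]
  have e2 : ∫ p in Rect, hφ p * (starRingEnd ℂ) (hψ p) * muC (2 * γ + 2) p =
      ∫ p in Rect, F p * (starRingEnd ℂ) (P p) * muC (2 * γ + 2) p :=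
    setIntegral_congr_fun measurableSet_Rect fun p hp => by
      simp only [H.eq_left p hp.2, K.eq_left p hp.2]
  rw [e1, e2, ← integral_const_mul,
    ← integral_add (integrableOn_Rect hX) (integrableOn_Rect hY)]
  refine Eq.trans ?_ (sub_zero _)
  rw [← hzero,
    ← integral_sub (integrableOn_Rect hXY) (integrableOn_Rect hZ)]
  refine setIntegral_congr_ae measurableSet_Rect ?_
  filter_upwards [ae_mem_strip_of_mem_Rect] with p hp hpR
  have hs := hp hpR
  have hc := cos_pos_of_mem_strip hs
  have hreal : (starRingEnd ℂ) (muC (2 * γ + 1) p) = muC (2 * γ + 1) p := Complex.conj_ofReal _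
  have hprod : muC (2 * γ + 1) p * muC (2 * γ + 1) p * muC (-(2 * γ)) p = muC (2 * γ + 2) p := by
    rw [muC_mul hc, muC_mul hc]
    congr 1
    ring
  rw [H.Tgam_eq γ hs, map_mul, hreal, K.eq_left p hpR.2,
    Tline_mul (hGd p) (hconj.differentiable (by simp) p), Tline_conj (hPd p), H.Tline_left, ← hprod, reducedTgam]
  push_cast
  ring

theorem setIntegral_Tgam_self {γ : ℝ} (hγ : -1 < γ) {h : ℝ × ℝ → ℂ} (mh : MemCapp h) :
    ∃ r : ℝ, 0 ≤ r ∧ (∫ p in Rect, Tgam γ (fun q => muC (2 * γ + 1) q * h q) p *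
      (starRingEnd ℂ) (muC (2 * γ + 1) p * h p) * muC (-(2 * γ)) p) = r := by
  have key : ∀ f : ℝ × ℝ → ℂ, ∃ r : ℝ, 0 ≤ r ∧
      ∫ p in Rect, f p * (starRingEnd ℂ) (f p) * muC (2 * γ + 2) p = r := fun f => by
    refine ⟨∫ p in Rect, Complex.normSq (f p) * Real.cos p.2 ^ (2 * γ + 2),
      setIntegral_nonneg measurableSet_Rect fun p hp => mul_nonneg (Complex.normSq_nonneg _)
        (Real.rpow_nonneg (Real.cos_nonneg_of_mem_Icc hp.2) _), ?_⟩
    rw [← integral_complex_ofReal]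
    simp only [Complex.mul_conj, muC, Complex.ofReal_mul]
  obtain ⟨r, hr, er⟩ := key (Tline h)
  obtain ⟨s, hs, es⟩ := key h
  refine ⟨r + (γ + 1) ^ 2 * s, by positivity, ?_⟩
  rw [setIntegral_Tgam_eq hγ mh mh, er, es]
  push_cast
  rfl

theorem setIntegral_Tgam_symm {γ : ℝ} (hγ : -1 < γ) {hφ hψ : ℝ × ℝ → ℂ} (mφ : MemCapp hφ)
    (mψ : MemCapp hψ) :
    (∫ p in Rect, Tgam γ (fun q => muC (2 * γ + 1) q * hφ q) p *
        (starRingEnd ℂ) (muC (2 * γ + 1) p * hψ p) * muC (-(2 * γ)) p)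
      = ∫ p in Rect, (muC (2 * γ + 1) p * hφ p) *
          (starRingEnd ℂ) (Tgam γ (fun q => muC (2 * γ + 1) q * hψ q) p) * muC (-(2 * γ)) p := by
  have hreal : ∀ e p, (starRingEnd ℂ) (muC e p) = muC e p := fun e p => Complex.conj_ofReal _
  have h := congrArg (starRingEnd ℂ) (setIntegral_Tgam_eq hγ mψ mφ)
  simp only [map_add, map_mul, map_pow, ← integral_conj, Complex.conj_conj, hreal,
    Complex.conj_ofReal, map_one] at h
  rw [setIntegral_Tgam_eq hγ mφ mψ]
  simp only [mul_comm] at h ⊢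
  exact h.symm

/-- (i) `𝓣_γ` maps `μ^{2γ+1} C^∞_{α,+,+}(∂₊S𝔻)` into itself.
(ii) For `φ = μ^{2γ+1} φ̃`, `ψ = μ^{2γ+1} ψ̃` with `φ̃, ψ̃ ∈ C^∞_{α,+,+}(∂₊S𝔻)`, one has
`⟨𝓣_γ φ, ψ⟩_{L²(μ^{-2γ})} = ⟨Tφ̃, Tψ̃⟩_{L²(μ^{2γ+2})} + (γ+1)²⟨φ̃, ψ̃⟩_{L²(μ^{2γ+2})}`;
in particular `𝓣_γ` is symmetric on this domain and `⟨𝓣_γ φ, φ⟩ ≥ 0`. -/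
theorem Tgamma_maps_and_symmetric (γ : ℝ) (hγ : -1 < γ) :
    (∀ h : ℝ × ℝ → ℂ, MemCapp h → ∃ h' : ℝ × ℝ → ℂ, MemCapp h' ∧
      ∀ p : ℝ × ℝ, p.2 ∈ Set.Ioo (-(π / 2)) (π / 2) →
        Tgam γ (fun q => muC (2 * γ + 1) q * h q) p = muC (2 * γ + 1) p * h' p) ∧
    (∀ hφ hψ : ℝ × ℝ → ℂ, MemCapp hφ → MemCapp hψ →
      (∫ p in Rect, Tgam γ (fun q => muC (2 * γ + 1) q * hφ q) p *
          (starRingEnd ℂ) (muC (2 * γ + 1) p * hψ p) * muC (-(2 * γ)) p)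
        = (∫ p in Rect, Tline hφ p * (starRingEnd ℂ) (Tline hψ p) * muC (2 * γ + 2) p)
          + ((γ : ℂ) + 1) ^ 2 *
            ∫ p in Rect, hφ p * (starRingEnd ℂ) (hψ p) * muC (2 * γ + 2) p) ∧
    (∀ hφ hψ : ℝ × ℝ → ℂ, MemCapp hφ → MemCapp hψ →
      (∫ p in Rect, Tgam γ (fun q => muC (2 * γ + 1) q * hφ q) p *
          (starRingEnd ℂ) (muC (2 * γ + 1) p * hψ p) * muC (-(2 * γ)) p)
        = ∫ p in Rect, (muC (2 * γ + 1) p * hφ p) *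
            (starRingEnd ℂ) (Tgam γ (fun q => muC (2 * γ + 1) q * hψ q) p) *
              muC (-(2 * γ)) p) ∧
    (∀ hφ : ℝ × ℝ → ℂ, MemCapp hφ →
      0 ≤ (∫ p in Rect, Tgam γ (fun q => muC (2 * γ + 1) q * hφ q) p *
            (starRingEnd ℂ) (muC (2 * γ + 1) p * hφ p) * muC (-(2 * γ)) p).re ∧
      (∫ p in Rect, Tgam γ (fun q => muC (2 * γ + 1) q * hφ q) p *
            (starRingEnd ℂ) (muC (2 * γ + 1) p * hφ p) * muC (-(2 * γ)) p).im = 0) := by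
  refine ⟨fun h mh => ?_, fun _ _ mφ mψ => setIntegral_Tgam_eq hγ mφ mψ,
    fun _ _ mφ mψ => setIntegral_Tgam_symm hγ mφ mψ, fun _ mφ => ?_⟩
  · obtain ⟨F, G, H⟩ := mh.exists_isExtension
    exact ⟨_, H.memCapp_reducedTgam γ, fun p hp => H.Tgam_eq γ hp⟩
  · obtain ⟨r, hr, e⟩ := setIntegral_Tgam_self hγ mφ
    rw [e]
    exact ⟨by simpa using hr, by simp⟩

end
end

section
/- For any b > −(1+γ)² and any n ∈ ℕ, the operator 𝓛_γ + b·id maps the space 𝒫_n of polynomials in (z, z̄) of total degree at most n into itself, is injective on C^∞(𝔻), and hence restricts to a linear isomorphism of 𝒫_n onto itself. -/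
open MeasureTheory Complex Metric Real Set

noncomputable section

/-- `𝒫_n`: polynomials in `(z, z̄)` of total degree at most `n`, as functions on `ℂ`. -/
def Pspace (n : ℕ) : Submodule ℂ (ℂ → ℂ) :=
  Submodule.span ℂ
    {f : ℂ → ℂ | ∃ a b : ℕ, a + b ≤ n ∧ f = fun z => z ^ a * ((starRingEnd ℂ) z) ^ b}

/-- The point of the plane with polar coordinates `(r, ω)`. -/
def polarPt (r ω : ℝ) : ℂ := (r : ℂ) * Complex.exp ((ω : ℂ) * Complex.I)

theorem norm_polarPt {r : ℝ} (hr : 0 < r) (ω : ℝ) : ‖polarPt r ω‖ = r := by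
  rw [polarPt, norm_mul, Complex.norm_exp_ofReal_mul_I, mul_one, Complex.norm_real,
    Real.norm_of_nonneg hr.le]

theorem polarPt_norm_arg (z : ℂ) : polarPt ‖z‖ z.arg = z :=
  Complex.norm_mul_exp_arg_mul_I z

theorem polarPt_ne_zero {r : ℝ} (hr : 0 < r) (ω : ℝ) : polarPt r ω ≠ 0 :=
  norm_pos_iff.mp (by rwa [norm_polarPt hr])

theorem polarPt_periodic (r : ℝ) : Function.Periodic (polarPt r) (2 * π) := by
  intro ω
  have h : (((ω + 2 * π : ℝ) : ℂ) * Complex.I) = (ω : ℂ) * Complex.I + 2 * π * Complex.I := by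
    push_cast; ring
  rw [polarPt, h, Complex.exp_periodic, polarPt]

theorem contDiff_polarPt {n : WithTop ℕ∞} :
    ContDiff ℝ n (fun p : ℝ × ℝ => polarPt p.1 p.2) := by
  unfold polarPt
  have h1 : ContDiff ℝ n (fun p : ℝ × ℝ => (p.1 : ℂ)) := Complex.ofRealCLM.contDiff.comp contDiff_fst
  have h2 : ContDiff ℝ n (fun p : ℝ × ℝ => (p.2 : ℂ)) := Complex.ofRealCLM.contDiff.comp contDiff_snd
  exact h1.mul (h2.mul contDiff_const).cexp

theorem exp_arg_polarPt {r : ℝ} (hr : 0 < r) (ω : ℝ) :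
    Complex.exp (((polarPt r ω).arg : ℂ) * Complex.I) = Complex.exp ((ω : ℂ) * Complex.I) := by
  have h := polarPt_norm_arg (polarPt r ω)
  rw [norm_polarPt hr] at h
  exact mul_left_cancel₀ (Complex.ofReal_ne_zero.mpr hr.ne') h

theorem dRho_polarPt (f : ℂ → ℂ) {r : ℝ} (hr : 0 < r) (ω : ℝ) :
    dRho f (polarPt r ω) = deriv (fun s => f (polarPt s ω)) r := by
  rw [dRho, exp_arg_polarPt hr, norm_polarPt hr]
  rfl

theorem dOmega_polarPt (f : ℂ → ℂ) {r : ℝ} (hr : 0 < r) (ω : ℝ) :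
    dOmega f (polarPt r ω) = deriv (fun w => f (polarPt r w)) ω := by
  obtain ⟨k, hk⟩ := Complex.exp_eq_exp_iff_exists_int.mp (exp_arg_polarPt hr ω)
  have harg : (polarPt r ω).arg = ω + k * (2 * π) := by
    have h : (((polarPt r ω).arg : ℂ)) = ω + k * (2 * π) :=
      mul_right_cancel₀ Complex.I_ne_zero (by rw [hk]; ring)
    exact_mod_cast h
  have h := deriv_comp_add_const (f := fun w => f (polarPt r w)) (k * (2 * π)) ω
  simp only [(polarPt_periodic r).int_mul k _] at h
  change deriv (fun w => f (polarPt ‖polarPt r ω‖ w)) _ = _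
  rw [norm_polarPt hr, harg, h]

theorem Lop_polarPt (γ : ℝ) (f : ℂ → ℂ) {r : ℝ} (hr : 0 < r) (ω : ℝ) :
    Lop γ f (polarPt r ω) =
      -(1 - (r : ℂ) ^ 2) * deriv (deriv fun s => f (polarPt s ω)) r -
        ((r : ℂ)⁻¹ - (3 + 2 * (γ : ℂ)) * r) * deriv (fun s => f (polarPt s ω)) r -
        ((r : ℂ) ^ 2)⁻¹ * deriv (deriv fun w => f (polarPt r w)) ω +
        ((γ : ℂ) + 1) ^ 2 * f (polarPt r ω) := by
  have h1 : (fun s => dRho f (polarPt s ω)) =ᶠ[nhds r] deriv fun s => f (polarPt s ω) := by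
    filter_upwards [lt_mem_nhds hr] with s hs using dRho_polarPt f hs ω
  have h2 : (fun w => dOmega f (polarPt r w)) = deriv fun w => f (polarPt r w) :=
    funext (dOmega_polarPt f hr)
  rw [Lop, dRho_polarPt _ hr, dOmega_polarPt _ hr, dRho_polarPt _ hr, norm_polarPt hr,
    h1.deriv_eq, h2]

theorem deriv_deriv_const_mul_add {u v : ℝ → ℂ} {x : ℝ} (a : ℂ)
    (hu : ContDiffAt ℝ 2 u x) (hv : ContDiffAt ℝ 2 v x) :
    deriv (fun t => a * u t + v t) x = a * deriv u x + deriv v x ∧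
      deriv (deriv fun t => a * u t + v t) x = a * deriv (deriv u) x + deriv (deriv v) x := by
  have h1 : ∀ {y}, ContDiffAt ℝ 2 u y → ContDiffAt ℝ 2 v y →
      deriv (fun t => a * u t + v t) y = a * deriv u y + deriv v y := by
    intro y hu hv
    exact (((hu.differentiableAt (by simp)).hasDerivAt.const_mul a).add
      (hv.differentiableAt (by simp)).hasDerivAt).deriv
  refine ⟨h1 hu hv, ?_⟩
  have hev : deriv (fun t => a * u t + v t) =ᶠ[nhds x] fun t => a * deriv u t + deriv v t := by
    filter_upwards [hu.eventually (by simp), hv.eventually (by simp)] with y hy hy'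
      using h1 hy hy'
  have hd : ∀ {w : ℝ → ℂ}, ContDiffAt ℝ 2 w x → DifferentiableAt ℝ (deriv w) x := by
    intro w hw
    have hw1 : ContDiffAt ℝ 1 (deriv w) x := by
      have := hw.fderiv_right (m := 1) (by norm_num)
      exact this.clm_apply contDiffAt_const
    exact hw1.differentiableAt (by simp)
  rw [hev.deriv_eq]
  exact (((hd hu).hasDerivAt.const_mul a).add (hd hv).hasDerivAt).deriv

theorem Lop_const_mul_add (γ : ℝ) (a : ℂ) {f g : ℂ → ℂ} {z : ℂ} (hz : z ≠ 0)
    (hf : ContDiffAt ℝ 2 f z) (hg : ContDiffAt ℝ 2 g z) :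
    Lop γ (fun w => a * f w + g w) z = a * Lop γ f z + Lop γ g z := by
  have hr : 0 < ‖z‖ := norm_pos_iff.mpr hz
  have hz' := polarPt_norm_arg z
  generalize ‖z‖ = r at hr hz'
  generalize z.arg = ω at hz'
  subst hz'
  have hs : ∀ {h : ℂ → ℂ}, ContDiffAt ℝ 2 h (polarPt r ω) →
      ContDiffAt ℝ 2 (fun s => h (polarPt s ω)) r := fun hh =>
    ContDiffAt.comp r hh
      (contDiff_polarPt.comp (contDiff_id.prodMk contDiff_const)).contDiffAt
  have hw : ∀ {h : ℂ → ℂ}, ContDiffAt ℝ 2 h (polarPt r ω) →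
      ContDiffAt ℝ 2 (fun w => h (polarPt r w)) ω := fun hh =>
    ContDiffAt.comp ω hh
      (contDiff_polarPt.comp (contDiff_const.prodMk contDiff_id)).contDiffAt
  obtain ⟨e1, e2⟩ := deriv_deriv_const_mul_add a (hs hf) (hs hg)
  obtain ⟨-, e3⟩ := deriv_deriv_const_mul_add a (hw hf) (hw hg)
  rw [Lop_polarPt _ _ hr, Lop_polarPt _ _ hr, Lop_polarPt _ _ hr, e1, e2, e3]
  ring

/-! ### Action on polynomials -/

theorem contDiff_of_mem_Pspace {n : ℕ} {f : ℂ → ℂ} (hf : f ∈ Pspace n) {k : WithTop ℕ∞} :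
    ContDiff ℝ k f := by
  induction hf using Submodule.span_induction with
  | mem f hf =>
    obtain ⟨a, b, -, rfl⟩ := hf
    exact (contDiff_id.pow a).mul (Complex.conjCLE.contDiff.pow b)
  | zero => exact contDiff_const
  | add f g _ _ hf hg => exact hf.add hg
  | smul c f _ hf => exact contDiff_const.smul hf

theorem monomial_mem_Pspace {n a b : ℕ} (h : a + b ≤ n) :
    (fun z : ℂ => z ^ a * ((starRingEnd ℂ) z) ^ b) ∈ Pspace n :=
  Submodule.subset_span ⟨a, b, h, rfl⟩

theorem Lop_monomial (γ : ℝ) (a b : ℕ) {z : ℂ} (hz : z ≠ 0) :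
    Lop γ (fun z : ℂ => z ^ a * ((starRingEnd ℂ) z) ^ b) z =
      ((a : ℂ) + b + γ + 1) ^ 2 * (z ^ a * ((starRingEnd ℂ) z) ^ b) -
        4 * a * b * (z ^ (a - 1) * ((starRingEnd ℂ) z) ^ (b - 1)) := by
  have hr : 0 < ‖z‖ := norm_pos_iff.mpr hz
  have hz' := polarPt_norm_arg z
  generalize ‖z‖ = r at hr hz'
  generalize z.arg = ω at hz'
  subst hz'
  have hconj : ∀ s w : ℝ, (starRingEnd ℂ) (polarPt s w) =
      (s : ℂ) * Complex.exp (-((w : ℂ) * Complex.I)) := by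
    intro s w
    rw [polarPt, map_mul, ← Complex.exp_conj]
    simp
  have hmono : ∀ s w : ℝ, polarPt s w ^ a * ((starRingEnd ℂ) (polarPt s w)) ^ b =
      (s : ℂ) ^ (a + b) * Complex.exp (((a : ℂ) - b) * Complex.I * w) := by
    intro s w
    rw [hconj, polarPt, mul_pow, mul_pow, ← Complex.exp_nat_mul, ← Complex.exp_nat_mul,
      mul_mul_mul_comm, ← pow_add, ← Complex.exp_add]
    ring_nf
  have hpow : ∀ (k : ℕ) (c : ℂ) (s : ℝ),
      HasDerivAt (fun s : ℝ => c * (s : ℂ) ^ k) (k * c * (s : ℂ) ^ (k - 1)) s := by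
    intro k c s
    have h := ((hasDerivAt_pow k (s : ℂ)).comp_ofReal).const_mul c
    exact h.congr_deriv (by ring)
  have hexp : ∀ (c m : ℂ) (w : ℝ),
      HasDerivAt (fun w : ℝ => c * Complex.exp (m * w)) (m * c * Complex.exp (m * w)) w := by
    intro c m w
    have h := ((((hasDerivAt_id (w : ℂ)).const_mul m).cexp).comp_ofReal).const_mul c
    exact h.congr_deriv (by simp only [id]; ring)
  have hR : (fun s : ℝ => polarPt s ω ^ a * ((starRingEnd ℂ) (polarPt s ω)) ^ b) =
      fun s : ℝ => Complex.exp (((a : ℂ) - b) * Complex.I * ω) * (s : ℂ) ^ (a + b) := by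
    funext s
    rw [hmono, mul_comm]
  have hW : (fun w : ℝ => polarPt r w ^ a * ((starRingEnd ℂ) (polarPt r w)) ^ b) =
      fun w : ℝ => (r : ℂ) ^ (a + b) * Complex.exp (((a : ℂ) - b) * Complex.I * w) :=
    funext fun w => hmono r w
  have hpow' : ∀ (k : ℕ) (c : ℂ), deriv (fun s : ℝ => c * (s : ℂ) ^ k) =
      fun s : ℝ => k * c * (s : ℂ) ^ (k - 1) := fun k c => funext fun s => (hpow k c s).deriv
  have hexp' : ∀ c m : ℂ, deriv (fun w : ℝ => c * Complex.exp (m * w)) =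
      fun w : ℝ => m * c * Complex.exp (m * w) := fun c m => funext fun w => (hexp c m w).deriv
  rw [Lop_polarPt γ _ hr, hR, hW, hpow', hpow', hexp', hexp', hmono]
  beta_reduce
  have hr' : (r : ℂ) ≠ 0 := Complex.ofReal_ne_zero.mpr hr.ne'
  have hlow : (4 * a * b * (polarPt r ω ^ (a - 1) * (starRingEnd ℂ) (polarPt r ω) ^ (b - 1)) : ℂ) =
      4 * a * b * ((r : ℂ) ^ 2)⁻¹ *
        ((r : ℂ) ^ (a + b) * Complex.exp (((a : ℂ) - b) * Complex.I * ω)) := by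
    rw [← hmono]
    rcases a with _ | a
    · simp
    rcases b with _ | b
    · simp
    have hsq : polarPt r ω * (starRingEnd ℂ) (polarPt r ω) = (r : ℂ) ^ 2 := by
      rw [Complex.mul_conj, Complex.normSq_eq_norm_sq, norm_polarPt hr]
      push_cast
      rfl
    have : polarPt r ω ^ (a + 1) * (starRingEnd ℂ) (polarPt r ω) ^ (b + 1) =
        (r : ℂ) ^ 2 * (polarPt r ω ^ a * (starRingEnd ℂ) (polarPt r ω) ^ b) := by
      rw [← hsq]
      ring
    rw [this]
    simp only [Nat.add_sub_cancel]
    field_simp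
  rw [hlow]
  generalize Complex.exp (((a : ℂ) - b) * Complex.I * ω) = E
  have hcast : ((a + b : ℕ) : ℂ) = (a : ℂ) + b := by push_cast; rfl
  have hd1 : ((a + b : ℕ) : ℂ) * (r : ℂ) ^ (a + b - 1) =
      ((a : ℂ) + b) * (r : ℂ)⁻¹ * (r : ℂ) ^ (a + b) := by
    rw [← hcast]
    rcases (a + b) with _ | k
    · simp
    · simp only [Nat.add_sub_cancel, pow_succ]
      field_simp
  have hd2 : ((a + b - 1 : ℕ) : ℂ) * ((a + b : ℕ) : ℂ) * (r : ℂ) ^ (a + b - 1 - 1) =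
      ((a : ℂ) + b) * ((a : ℂ) + b - 1) * ((r : ℂ) ^ 2)⁻¹ * (r : ℂ) ^ (a + b) := by
    rw [← hcast]
    rcases (a + b) with _ | _ | k
    · simp
    · simp
    · simp only [Nat.add_sub_cancel, pow_succ]
      push_cast
      field_simp
      ring
  have e1 : ((a + b : ℕ) : ℂ) * E * (r : ℂ) ^ (a + b - 1) =
      ((a : ℂ) + b) * (r : ℂ)⁻¹ * (r : ℂ) ^ (a + b) * E := by
    rw [← hd1]; ring
  have e2 : ((a + b - 1 : ℕ) : ℂ) * (((a + b : ℕ) : ℂ) * E) * (r : ℂ) ^ (a + b - 1 - 1) =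
      ((a : ℂ) + b) * ((a : ℂ) + b - 1) * ((r : ℂ) ^ 2)⁻¹ * (r : ℂ) ^ (a + b) * E := by
    rw [← hd2]; ring
  rw [e1, e2]
  generalize (r : ℂ) ^ (a + b) = Q
  have hI : ∀ x : ℂ, (x * Complex.I) * (x * Complex.I * Q) = -(x ^ 2 * Q) := by
    intro x
    linear_combination x ^ 2 * Q * Complex.I_sq
  rw [hI]
  field_simp
  ring

theorem Lop_add (γ : ℝ) {f g : ℂ → ℂ} {z : ℂ} (hz : z ≠ 0)
    (hf : ContDiffAt ℝ 2 f z) (hg : ContDiffAt ℝ 2 g z) :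
    Lop γ (f + g) z = Lop γ f z + Lop γ g z := by
  have h := Lop_const_mul_add γ 1 hz hf hg
  simp only [one_mul] at h
  exact h

theorem Lop_smul (γ : ℝ) (c : ℂ) {f : ℂ → ℂ} {z : ℂ} (hz : z ≠ 0) (hf : ContDiffAt ℝ 2 f z) :
    Lop γ (c • f) z = c * Lop γ f z := by
  have h := Lop_const_mul_add γ (c - 1) hz hf hf
  have e : (fun w => (c - 1) * f w + f w) = c • f := by
    funext w
    rw [Pi.smul_apply, smul_eq_mul]
    ring
  rw [e] at h
  rw [h]
  ring

theorem Lop_zero (γ : ℝ) {z : ℂ} (hz : z ≠ 0) : Lop γ 0 z = 0 := by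
  have h := Lop_smul γ 0 (f := 0) hz contDiffAt_const
  simpa using h

theorem exists_mem_Pspace_Lop_add_eq (γ b : ℝ) {n : ℕ} {f : ℂ → ℂ} (hf : f ∈ Pspace n) :
    ∃ g ∈ Pspace n, ∀ z : ℂ, z ≠ 0 → Lop γ f z + (b : ℂ) * f z = g z := by
  induction hf using Submodule.span_induction with
  | mem f hf =>
    obtain ⟨k, l, hkl, rfl⟩ := hf
    refine ⟨(((k : ℂ) + l + γ + 1) ^ 2 + b) • (fun z => z ^ k * ((starRingEnd ℂ) z) ^ l) -
      (4 * k * l : ℂ) • fun z => z ^ (k - 1) * ((starRingEnd ℂ) z) ^ (l - 1),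
      Submodule.sub_mem _ (Submodule.smul_mem _ _ (monomial_mem_Pspace hkl))
        (Submodule.smul_mem _ _ (monomial_mem_Pspace (by omega))), fun z hz => ?_⟩
    rw [Lop_monomial γ k l hz]
    simp only [Pi.sub_apply, Pi.smul_apply, smul_eq_mul]
    ring
  | zero =>
    refine ⟨0, Submodule.zero_mem _, fun z hz => ?_⟩
    rw [Lop_zero γ hz]
    simp
  | add f₁ f₂ hf₁ hf₂ ih₁ ih₂ =>
    obtain ⟨g₁, hg₁, h₁⟩ := ih₁
    obtain ⟨g₂, hg₂, h₂⟩ := ih₂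
    refine ⟨g₁ + g₂, Submodule.add_mem _ hg₁ hg₂, fun z hz => ?_⟩
    rw [Lop_add γ hz (contDiff_of_mem_Pspace hf₁).contDiffAt
      (contDiff_of_mem_Pspace hf₂).contDiffAt]
    simp only [Pi.add_apply, ← h₁ z hz, ← h₂ z hz]
    ring
  | smul c f hf ih =>
    obtain ⟨g, hg, h⟩ := ih
    refine ⟨c • g, Submodule.smul_mem _ _ hg, fun z hz => ?_⟩
    rw [Lop_smul γ c hz (contDiff_of_mem_Pspace hf).contDiffAt]
    simp only [Pi.smul_apply, smul_eq_mul, ← h z hz]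
    ring

theorem Pspace_mono {m n : ℕ} (h : m ≤ n) : Pspace m ≤ Pspace n :=
  Submodule.span_mono fun _ ⟨k, l, hkl, hf⟩ => ⟨k, l, hkl.trans h, hf⟩

theorem exists_preimage_monomial {γ b : ℝ} (hγ : -1 < γ) (hb : -((1 + γ) ^ 2) < b) (k l : ℕ) :
    ∃ f ∈ Pspace (k + l), ∀ z : ℂ, z ≠ 0 →
      Lop γ f z + (b : ℂ) * f z = z ^ k * ((starRingEnd ℂ) z) ^ l := by
  have key : ∀ k l : ℕ, (∃ f ∈ Pspace (k + l), ∀ z : ℂ, z ≠ 0 → Lop γ f z + (b : ℂ) * f z =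
      4 * k * l * (z ^ (k - 1) * ((starRingEnd ℂ) z) ^ (l - 1))) →
      ∃ f ∈ Pspace (k + l), ∀ z : ℂ, z ≠ 0 →
        Lop γ f z + (b : ℂ) * f z = z ^ k * ((starRingEnd ℂ) z) ^ l := by
    rintro k l ⟨f, hf, h⟩
    have hpos : 0 < ((k : ℝ) + l + γ + 1) ^ 2 + b := by
      have hk : (0 : ℝ) ≤ k + l := by positivity
      nlinarith
    have hne : ((k : ℂ) + l + γ + 1) ^ 2 + b ≠ 0 := by exact_mod_cast hpos.ne'
    have hm := monomial_mem_Pspace (le_refl (k + l))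
    have hs := Submodule.add_mem _ hm hf
    refine ⟨(((k : ℂ) + l + γ + 1) ^ 2 + b)⁻¹ • ((fun z => z ^ k * ((starRingEnd ℂ) z) ^ l) + f),
      Submodule.smul_mem _ _ hs, fun z hz => ?_⟩
    rw [Lop_smul γ _ hz (contDiff_of_mem_Pspace hs).contDiffAt,
      Lop_add γ hz (contDiff_of_mem_Pspace hm).contDiffAt (contDiff_of_mem_Pspace hf).contDiffAt,
      Lop_monomial γ k l hz]
    simp only [Pi.smul_apply, Pi.add_apply, smul_eq_mul]
    rw [eq_sub_of_add_eq (h z hz)]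
    generalize z ^ (k - 1) * ((starRingEnd ℂ) z) ^ (l - 1) = q
    generalize z ^ k * ((starRingEnd ℂ) z) ^ l = p
    field_simp
    ring
  have hzero : ∀ k l : ℕ, k = 0 ∨ l = 0 → ∃ f ∈ Pspace (k + l), ∀ z : ℂ, z ≠ 0 →
      Lop γ f z + (b : ℂ) * f z = 4 * k * l * (z ^ (k - 1) * ((starRingEnd ℂ) z) ^ (l - 1)) := by
    refine fun k l hkl => ⟨0, Submodule.zero_mem _, fun z hz => ?_⟩
    rw [Lop_zero γ hz]
    rcases hkl with rfl | rfl <;> simp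
  induction k generalizing l with
  | zero => exact key _ _ (hzero _ _ (Or.inl rfl))
  | succ k ih =>
    rcases l with _ | l
    · exact key _ _ (hzero _ _ (Or.inr rfl))
    · obtain ⟨f, hf, h⟩ := ih l
      refine key _ _ ⟨(4 * (k + 1 : ℕ) * (l + 1 : ℕ) : ℂ) • f,
        Submodule.smul_mem _ _ (Pspace_mono (by omega) hf), fun z hz => ?_⟩
      rw [Lop_smul γ _ hz (contDiff_of_mem_Pspace hf).contDiffAt]
      simp only [Pi.smul_apply, smul_eq_mul, Nat.add_sub_cancel, ← h z hz]
      ring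

theorem exists_preimage_mem_Pspace {γ b : ℝ} (hγ : -1 < γ) (hb : -((1 + γ) ^ 2) < b) {n : ℕ}
    {g : ℂ → ℂ} (hg : g ∈ Pspace n) :
    ∃ f ∈ Pspace n, ∀ z : ℂ, z ≠ 0 → Lop γ f z + (b : ℂ) * f z = g z := by
  induction hg using Submodule.span_induction with
  | mem g hg =>
    obtain ⟨k, l, hkl, rfl⟩ := hg
    obtain ⟨f, hf, h⟩ := exists_preimage_monomial hγ hb k l
    exact ⟨f, Pspace_mono hkl hf, h⟩
  | zero =>
    refine ⟨0, Submodule.zero_mem _, fun z hz => ?_⟩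
    rw [Lop_zero γ hz]
    simp
  | add g₁ g₂ _ _ ih₁ ih₂ =>
    obtain ⟨f₁, hf₁, h₁⟩ := ih₁
    obtain ⟨f₂, hf₂, h₂⟩ := ih₂
    refine ⟨f₁ + f₂, Submodule.add_mem _ hf₁ hf₂, fun z hz => ?_⟩
    rw [Lop_add γ hz (contDiff_of_mem_Pspace hf₁).contDiffAt
      (contDiff_of_mem_Pspace hf₂).contDiffAt]
    simp only [Pi.add_apply, ← h₁ z hz, ← h₂ z hz]
    ring
  | smul c g _ ih =>
    obtain ⟨f, hf, h⟩ := ih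
    refine ⟨c • f, Submodule.smul_mem _ _ hf, fun z hz => ?_⟩
    rw [Lop_smul γ c hz (contDiff_of_mem_Pspace hf).contDiffAt]
    simp only [Pi.smul_apply, smul_eq_mul, ← h z hz]
    ring

theorem analyticOnNhd_of_mem_Pspace {n : ℕ} {f : ℂ → ℂ} (hf : f ∈ Pspace n) :
    AnalyticOnNhd ℝ f Set.univ :=
  analyticOn_univ.mp (contDiff_of_mem_Pspace hf).contDiffOn.analyticOn

theorem eq_of_mem_Pspace_of_eqOn {n : ℕ} {f g : ℂ → ℂ} (hf : f ∈ Pspace n) (hg : g ∈ Pspace n)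
    (h : Set.EqOn f g (Metric.closedBall 0 1)) : f = g :=
  (analyticOnNhd_of_mem_Pspace hf).eq_of_eventuallyEq (analyticOnNhd_of_mem_Pspace hg)
    (z₀ := 0) (h.eventuallyEq_of_mem (Metric.closedBall_mem_nhds 0 one_pos))

/-! ### Injectivity via a maximum principle -/

theorem IsLocalMax.second_deriv_nonpos {g g' : ℝ → ℝ} {x g'' : ℝ} (hmax : IsLocalMax g x)
    (hg : ∀ᶠ y in nhds x, HasDerivAt g (g' y) y) (hg' : HasDerivAt g' g'' x) : g'' ≤ 0 := by
  by_contra! hpos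
  have hev : deriv g =ᶠ[nhds x] g' := hg.mono fun y hy => hy.deriv
  have h2 : deriv (deriv g) x = g'' := by rw [hev.deriv_eq, hg'.deriv]
  have hmin := isLocalMin_of_deriv_deriv_pos (h2 ▸ hpos) hmax.deriv_eq_zero
    hg.self_of_nhds.continuousAt
  have hconst : g =ᶠ[nhds x] fun _ => g x := by
    filter_upwards [hmax, hmin] with y h1 h2 using le_antisymm h1 h2
  have h3 : deriv g =ᶠ[nhds x] fun _ => 0 := by
    simpa using hconst.deriv
  rw [h3.deriv_eq, deriv_const] at h2
  exact hpos.ne h2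

/-- A maximum principle for the operator `𝓛_γ + b` in polar coordinates on the punctured closed
disk, with `c = (γ + 1)² + b`. The singular barrier `ε log r` excludes a maximum at the origin. -/
theorem polar_max_principle {γ c : ℝ} (hγ : -1 < γ) (hc : 0 < c)
    {U Ur Urr Uw Uww : ℝ × ℝ → ℝ} (hU : ContinuousOn U (Set.Icc 0 1 ×ˢ Set.univ))
    (hper : ∀ r w, U (r, w + 2 * π) = U (r, w))
    (hUr : ∀ r ∈ Set.Icc (0 : ℝ) 1, ∀ w,
      HasDerivWithinAt (fun s => U (s, w)) (Ur (r, w)) (Set.Icc 0 1) r)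
    (hUrr : ∀ r ∈ Set.Icc (0 : ℝ) 1, ∀ w,
      HasDerivWithinAt (fun s => Ur (s, w)) (Urr (r, w)) (Set.Icc 0 1) r)
    (hUw : ∀ r ∈ Set.Icc (0 : ℝ) 1, ∀ w, HasDerivAt (fun x => U (r, x)) (Uw (r, w)) w)
    (hUww : ∀ r ∈ Set.Icc (0 : ℝ) 1, ∀ w, HasDerivAt (fun x => Uw (r, x)) (Uww (r, w)) w)
    (heq : ∀ r ∈ Set.Ioc (0 : ℝ) 1, ∀ w, -(1 - r ^ 2) * Urr (r, w) -
      (r⁻¹ - (3 + 2 * γ) * r) * Ur (r, w) - (r ^ 2)⁻¹ * Uww (r, w) + c * U (r, w) = 0)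
    {r₁ : ℝ} (hr₁ : r₁ ∈ Set.Ioc (0 : ℝ) 1) (w₁ : ℝ) : U (r₁, w₁) ≤ 0 := by
  have hperiodic : ∀ r, Function.Periodic (fun w => U (r, w)) (2 * π) := hper
  have hmax : ∀ ε > 0, ∀ r₀ ∈ Set.Ioc (0 : ℝ) 1, ∀ w₀,
      (∀ᶠ s in nhdsWithin r₀ (Set.Icc 0 1),
        U (s, w₀) + ε * Real.log s ≤ U (r₀, w₀) + ε * Real.log r₀) →
      (∀ w, U (r₀, w) ≤ U (r₀, w₀)) → c * U (r₀, w₀) ≤ ε * (2 + 2 * γ) := by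
    intro ε hε r₀ hr₀ w₀ hrmax hwmax
    have hI : r₀ ∈ Set.Icc (0 : ℝ) 1 := ⟨hr₀.1.le, hr₀.2⟩
    have hww : Uww (r₀, w₀) ≤ 0 :=
      IsLocalMax.second_deriv_nonpos (g := fun w => U (r₀, w)) (g' := fun w => Uw (r₀, w))
        (Filter.Eventually.of_forall hwmax) (Filter.Eventually.of_forall (hUw r₀ hI))
        (hUww r₀ hI w₀)
    have hww' : (r₀ ^ 2)⁻¹ * Uww (r₀, w₀) ≤ 0 :=
      mul_nonpos_of_nonneg_of_nonpos (by positivity) hww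
    have hE := heq r₀ hr₀ w₀
    rcases hr₀.2.lt_or_eq with hlt | rfl
    · have hnhds : ∀ s ∈ Set.Ioo (0 : ℝ) 1, Set.Icc (0 : ℝ) 1 ∈ nhds s :=
        fun s hs => Icc_mem_nhds hs.1 hs.2
      have hR : ∀ s ∈ Set.Ioo (0 : ℝ) 1, HasDerivAt (fun s => U (s, w₀) + ε * Real.log s)
          (Ur (s, w₀) + ε * s⁻¹) s := fun s hs =>
        ((hUr s ⟨hs.1.le, hs.2.le⟩ w₀).hasDerivAt (hnhds s hs)).add
          ((Real.hasDerivAt_log hs.1.ne').const_mul ε)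
      have h0 : r₀ ∈ Set.Ioo (0 : ℝ) 1 := ⟨hr₀.1, hlt⟩
      have hloc : IsLocalMax (fun s => U (s, w₀) + ε * Real.log s) r₀ := by
        rwa [nhdsWithin_eq_nhds.mpr (hnhds r₀ h0)] at hrmax
      have hfst := hloc.hasDerivAt_eq_zero (hR r₀ h0)
      have hsnd := hloc.second_deriv_nonpos
        (g' := fun s => Ur (s, w₀) + ε * s⁻¹)
        ((Ioo_mem_nhds h0.1 h0.2 : _ ∈ nhds r₀) |> Filter.mem_of_superset <| hR)
        (((hUrr r₀ hI w₀).hasDerivAt (hnhds r₀ h0)).add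
          ((hasDerivAt_inv hr₀.1.ne').const_mul ε))
      have hq : 0 < 1 - r₀ ^ 2 := by nlinarith [hr₀.1]
      have e1 : Ur (r₀, w₀) = -(ε * r₀⁻¹) := by linarith
      have e2 := mul_le_mul_of_nonneg_left hsnd hq.le
      rw [e1] at hE
      have hr0 := hr₀.1.ne'
      have e3 : (r₀⁻¹ - (3 + 2 * γ) * r₀) * -(ε * r₀⁻¹) =
          -(ε * (r₀ ^ 2)⁻¹) + (3 + 2 * γ) * ε := by
        field_simp
        ring
      have e4 : (1 - r₀ ^ 2) * (ε * -(r₀ ^ 2)⁻¹) = -(ε * (r₀ ^ 2)⁻¹) + ε := by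
        field_simp
        ring
      rw [e3] at hE
      rw [mul_add, e4] at e2
      linarith
    · have hloc : IsLocalMaxOn (fun s => U (s, w₀) + ε * Real.log s) (Set.Icc 0 1) 1 := hrmax
      have hd := (hUr 1 hI w₀).add
        (((Real.hasDerivAt_log one_ne_zero).const_mul ε).hasDerivWithinAt (s := Set.Icc 0 1))
      have hcone : (-1 : ℝ) ∈ posTangentConeAt (Set.Icc (0 : ℝ) 1) 1 := by
        have := sub_mem_posTangentConeAt_of_segment_subset (s := Set.Icc (0 : ℝ) 1) (x := 1) (y := 0)
          ((convex_Icc (0 : ℝ) 1).segment_subset (by simp) (by simp))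
        simpa using this
      have hn := hloc.hasFDerivWithinAt_nonpos hd.hasFDerivWithinAt hcone
      simp at hn
      have hg : 0 < 2 + 2 * γ := by linarith
      have := mul_le_mul_of_nonneg_left hn hg.le
      norm_num at hE hww'
      nlinarith
  have hsmall : ∀ ε > 0, c * (U (r₁, w₁) + ε * Real.log r₁) ≤ ε * (2 + 2 * γ) := by
    intro ε hε
    obtain ⟨M, hM⟩ : ∃ M, ∀ r ∈ Set.Icc (0 : ℝ) 1, ∀ w, U (r, w) ≤ M := by
      have hK : IsCompact (Set.Icc (0 : ℝ) 1 ×ˢ Set.Icc 0 (2 * π)) := isCompact_Icc.prod isCompact_Icc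
      obtain ⟨M, hM⟩ := hK.bddAbove_image (hU.mono (Set.prod_mono_right (Set.subset_univ _)))
      refine ⟨M, fun r hr w => ?_⟩
      obtain ⟨y, hy, hyw⟩ := (hperiodic r).exists_mem_Ico₀ Real.two_pi_pos w
      exact hyw.trans_le (hM ⟨(r, y), ⟨hr, hy.1, hy.2.le⟩, rfl⟩)
    obtain ⟨δ, hδ, hδ₁, hbar⟩ : ∃ δ, 0 < δ ∧ δ ≤ r₁ ∧
        ∀ s, 0 < s → s ≤ δ → M + ε * Real.log s < U (r₁, w₁) + ε * Real.log r₁ := by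
      have ht := Real.tendsto_log_nhdsGT_zero.eventually
        (Filter.eventually_lt_atBot ((U (r₁, w₁) + ε * Real.log r₁ - M) / ε))
      obtain ⟨δ, hδ, hsub⟩ := mem_nhdsGT_iff_exists_Ioc_subset.mp ht
      refine ⟨min δ r₁, lt_min hδ hr₁.1, min_le_right _ _, fun s hs hsδ => ?_⟩
      have := hsub ⟨hs, hsδ.trans (min_le_left _ _)⟩
      rw [Set.mem_ofPred_eq, lt_div_iff₀ hε] at this
      linarith
    have hK : IsCompact (Set.Icc δ 1 ×ˢ Set.Icc 0 (2 * π)) := isCompact_Icc.prod isCompact_Icc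
    have hcont : ContinuousOn (fun p : ℝ × ℝ => U p + ε * Real.log p.1)
        (Set.Icc δ 1 ×ˢ Set.Icc 0 (2 * π)) := by
      refine (hU.mono (Set.prod_mono (Set.Icc_subset_Icc_left hδ.le) (Set.subset_univ _))).add
        (continuousOn_const.mul (continuousOn_fst.log fun p hp => ?_))
      exact (hδ.trans_le hp.1.1).ne'
    obtain ⟨⟨r₀, w₀⟩, hp, hpmax⟩ := hK.exists_isMaxOn
      ⟨(1, 0), ⟨hδ₁.trans hr₁.2, le_rfl⟩, le_rfl, Real.two_pi_pos.le⟩ hcont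
    have hglob' : ∀ s ∈ Set.Icc δ 1, ∀ w,
        U (s, w) + ε * Real.log s ≤ U (r₀, w₀) + ε * Real.log r₀ := by
      intro s hs w
      obtain ⟨y, hy, hyw⟩ := (hperiodic s).exists_mem_Ico₀ Real.two_pi_pos w
      have hle : U (s, y) + ε * Real.log s ≤ U (r₀, w₀) + ε * Real.log r₀ :=
        hpmax (show (s, y) ∈ _ from ⟨hs, hy.1, hy.2.le⟩)
      rwa [← show U (s, w) = U (s, y) from hyw] at hle
    have h1 := hglob' r₁ ⟨hδ₁, hr₁.2⟩ w₁
    have hglob : ∀ s ∈ Set.Ioc (0 : ℝ) 1, ∀ w,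
        U (s, w) + ε * Real.log s ≤ U (r₀, w₀) + ε * Real.log r₀ := by
      intro s hs w
      rcases le_total δ s with h | h
      · exact hglob' s ⟨h, hs.2⟩ w
      · linarith [hbar s hs.1 h, hM s ⟨hs.1.le, hs.2⟩ w]
    have hr₀ : r₀ ∈ Set.Ioc (0 : ℝ) 1 := ⟨hδ.trans_le hp.1.1, hp.1.2⟩
    have h2 := hmax ε hε r₀ hr₀ w₀
      (by
        filter_upwards [self_mem_nhdsWithin, mem_nhdsWithin_of_mem_nhds (lt_mem_nhds hr₀.1)]
          with s hs hs' using hglob s ⟨hs', hs.2⟩ w₀)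
      (fun w => by linarith [hglob r₀ hr₀ w])
    have h3 : U (r₁, w₁) + ε * Real.log r₁ ≤ U (r₀, w₀) := by
      have := mul_nonpos_of_nonneg_of_nonpos hε.le (Real.log_nonpos hr₀.1.le hr₀.2)
      linarith
    exact (mul_le_mul_of_nonneg_left h3 hc.le).trans h2
  have hlim : Filter.Tendsto (fun ε : ℝ => ε * (2 + 2 * γ) - c * (U (r₁, w₁) + ε * Real.log r₁))
      (nhdsWithin 0 (Set.Ioi 0)) (nhds (0 * (2 + 2 * γ) - c * (U (r₁, w₁) + 0 * Real.log r₁))) :=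
    (Continuous.tendsto (by fun_prop) 0).mono_left nhdsWithin_le_nhds
  have := ge_of_tendsto hlim (b := 0)
    (by filter_upwards [self_mem_nhdsWithin] with ε hε using sub_nonneg.mpr (hsmall ε hε))
  nlinarith

/-- The partial derivative of `G` in direction `v` along the closed strip `[0, 1] × ℝ`. -/
def stripDeriv (v : ℝ × ℝ) (G : ℝ × ℝ → ℂ) (p : ℝ × ℝ) : ℂ :=
  fderivWithin ℝ G (Set.Icc 0 1 ×ˢ Set.univ) p v

theorem contDiffOn_stripDeriv {G : ℝ × ℝ → ℂ} (v : ℝ × ℝ)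
    (hG : ContDiffOn ℝ (⊤ : ℕ∞) G (Set.Icc 0 1 ×ˢ Set.univ)) :
    ContDiffOn ℝ (⊤ : ℕ∞) (stripDeriv v G) (Set.Icc 0 1 ×ˢ Set.univ) :=
  (hG.fderivWithin ((uniqueDiffOn_Icc zero_lt_one).prod uniqueDiffOn_univ) (by simp)).clm_apply
    contDiffOn_const

theorem hasDerivWithinAt_stripDeriv_fst {G : ℝ × ℝ → ℂ}
    (hG : ContDiffOn ℝ (⊤ : ℕ∞) G (Set.Icc 0 1 ×ˢ Set.univ)) {r : ℝ} (hr : r ∈ Set.Icc (0 : ℝ) 1)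
    (w : ℝ) : HasDerivWithinAt (fun s => G (s, w)) (stripDeriv (1, 0) G (r, w)) (Set.Icc 0 1) r := by
  have h := (hG.differentiableOn (by simp) (r, w) ⟨hr, trivial⟩).hasFDerivWithinAt
  exact h.comp_hasDerivWithinAt r
    ((hasDerivAt_id r).prodMk (hasDerivAt_const r w)).hasDerivWithinAt fun s hs =>
      Set.mk_mem_prod hs (Set.mem_univ w)

theorem hasDerivAt_stripDeriv_snd {G : ℝ × ℝ → ℂ}
    (hG : ContDiffOn ℝ (⊤ : ℕ∞) G (Set.Icc 0 1 ×ˢ Set.univ)) {r : ℝ} (hr : r ∈ Set.Icc (0 : ℝ) 1)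
    (w : ℝ) : HasDerivAt (fun x => G (r, x)) (stripDeriv (0, 1) G (r, w)) w := by
  have h := (hG.differentiableOn (by simp) (r, w) ⟨hr, trivial⟩).hasFDerivWithinAt
  rw [← hasDerivWithinAt_univ]
  exact h.comp_hasDerivWithinAt w
    ((hasDerivAt_const w r).prodMk (hasDerivAt_id w)).hasDerivWithinAt fun x _ =>
      Set.mk_mem_prod hr (Set.mem_univ x)

theorem eqOn_zero_of_Lop_add_eq_zero {γ b : ℝ} (hγ : -1 < γ) (hb : -((1 + γ) ^ 2) < b) {f : ℂ → ℂ}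
    (hf : CinfDisk f) (h : ∀ z ∈ Metric.ball (0 : ℂ) 1, z ≠ 0 → Lop γ f z + (b : ℂ) * f z = 0) :
    Set.EqOn f 0 (Metric.closedBall 0 1 \ {0}) := by
  set S : Set (ℝ × ℝ) := Set.Icc 0 1 ×ˢ Set.univ
  set F : ℝ × ℝ → ℂ := fun p => f (polarPt p.1 p.2) with hF
  have hFS : ContDiffOn ℝ (⊤ : ℕ∞) F S := by
    refine hf.comp contDiff_polarPt.contDiffOn fun p hp => ?_
    rw [mem_closedBall_zero_iff, polarPt, norm_mul, Complex.norm_exp_ofReal_mul_I, mul_one,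
      Complex.norm_real, Real.norm_of_nonneg hp.1.1]
    exact hp.1.2
  set Fr := stripDeriv (1, 0) F
  set Frr := stripDeriv (1, 0) Fr
  set Fw := stripDeriv (0, 1) F
  set Fww := stripDeriv (0, 1) Fw
  have hFr : ContDiffOn ℝ (⊤ : ℕ∞) Fr S := contDiffOn_stripDeriv _ hFS
  have hFrr : ContDiffOn ℝ (⊤ : ℕ∞) Frr S := contDiffOn_stripDeriv _ hFr
  have hFw : ContDiffOn ℝ (⊤ : ℕ∞) Fw S := contDiffOn_stripDeriv _ hFS
  have hFww : ContDiffOn ℝ (⊤ : ℕ∞) Fww S := contDiffOn_stripDeriv _ hFw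
  let E : ℝ → ℝ → ℂ := fun w r => ((-(1 - r ^ 2) : ℝ) : ℂ) * Frr (r, w) -
    ((r⁻¹ - (3 + 2 * γ) * r : ℝ) : ℂ) * Fr (r, w) - (((r ^ 2)⁻¹ : ℝ) : ℂ) * Fww (r, w) +
    (((γ + 1) ^ 2 + b : ℝ) : ℂ) * F (r, w)
  have hinterior : ∀ w, ∀ r ∈ Set.Ioo (0 : ℝ) 1, E w r = 0 := by
    intro w r hr
    have hd : ∀ {G : ℝ × ℝ → ℂ}, ContDiffOn ℝ (⊤ : ℕ∞) G S → ∀ s ∈ Set.Ioo (0 : ℝ) 1,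
        deriv (fun s => G (s, w)) s = stripDeriv (1, 0) G (s, w) := fun hG s hs =>
      ((hasDerivWithinAt_stripDeriv_fst hG ⟨hs.1.le, hs.2.le⟩ w).hasDerivAt
        (Icc_mem_nhds hs.1 hs.2)).deriv
    have hdw : ∀ {G : ℝ × ℝ → ℂ}, ContDiffOn ℝ (⊤ : ℕ∞) G S →
        (deriv fun x => G (r, x)) = fun x => stripDeriv (0, 1) G (r, x) := fun hG =>
      funext fun x => (hasDerivAt_stripDeriv_snd hG ⟨hr.1.le, hr.2.le⟩ x).deriv
    have hev : deriv (fun s => F (s, w)) =ᶠ[nhds r] fun s => Fr (s, w) := by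
      filter_upwards [Ioo_mem_nhds hr.1 hr.2] with s hs using hd hFS s hs
    have hz := h (polarPt r w) (by rw [mem_ball_zero_iff, norm_polarPt hr.1]; exact hr.2)
      (polarPt_ne_zero hr.1 w)
    rw [Lop_polarPt γ f hr.1] at hz
    change -(1 - (r : ℂ) ^ 2) * deriv (deriv fun s => F (s, w)) r -
        ((r : ℂ)⁻¹ - (3 + 2 * (γ : ℂ)) * r) * deriv (fun s => F (s, w)) r -
        ((r : ℂ) ^ 2)⁻¹ * deriv (deriv fun x => F (r, x)) w +
        ((γ : ℂ) + 1) ^ 2 * F (r, w) + b * F (r, w) = 0 at hz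
    rw [hev.deriv_eq, hd hFr r hr, hd hFS r hr, hdw hFS, hdw hFw] at hz
    rw [← hz]
    simp only [E]
    push_cast
    ring
  have hE : ∀ w, ∀ r ∈ Set.Ioc (0 : ℝ) 1, E w r = 0 := by
    intro w
    have hslice : ∀ {G : ℝ × ℝ → ℂ}, ContDiffOn ℝ (⊤ : ℕ∞) G S →
        ContinuousOn (fun r => G (r, w)) (Set.Ioc 0 1) := fun hG =>
      hG.continuousOn.comp (by fun_prop) fun r hr => ⟨⟨hr.1.le, hr.2⟩, trivial⟩
    have hreal : ∀ {g : ℝ → ℝ}, ContinuousOn g (Set.Ioc 0 1) →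
        ContinuousOn (fun r => (g r : ℂ)) (Set.Ioc 0 1) := fun hg =>
      Complex.continuous_ofReal.comp_continuousOn hg
    have hinv : ContinuousOn (fun r : ℝ => r⁻¹) (Set.Ioc 0 1) :=
      continuousOn_id.inv₀ fun r hr => hr.1.ne'
    have hinv2 : ContinuousOn (fun r : ℝ => (r ^ 2)⁻¹) (Set.Ioc 0 1) :=
      (continuousOn_id.pow 2).inv₀ fun r hr => pow_ne_zero 2 hr.1.ne'
    have hcont : ContinuousOn (E w) (Set.Ioc 0 1) :=
      ((((hreal (by fun_prop)).mul (hslice hFrr)).sub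
        ((hreal (hinv.sub (by fun_prop))).mul (hslice hFr))).sub
        ((hreal hinv2).mul (hslice hFww))).add (continuousOn_const.mul (hslice hFS))
    have heq : Set.EqOn (E w) (fun _ => 0) (Set.Ioo 0 1) := hinterior w
    exact heq.of_subset_closure hcont continuousOn_const Set.Ioo_subset_Ioc_self
      (by rw [closure_Ioo zero_ne_one]; exact Set.Ioc_subset_Icc_self)
  have hc : 0 < (γ + 1) ^ 2 + b := by linarith [add_comm γ 1 ▸ hb]
  have hre : ∀ a : ℂ, ∀ r ∈ Set.Ioc (0 : ℝ) 1, ∀ w, (a * F (r, w)).re ≤ 0 := by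
    intro a r hr w
    let ℓ : ℂ →L[ℝ] ℝ := Complex.reCLM.comp (ContinuousLinearMap.mul ℝ ℂ a)
    have hsmul : ∀ (x : ℝ) (z : ℂ), ℓ ((x : ℂ) * z) = x * ℓ z := fun x z => by
      rw [← Complex.real_smul, map_smul, smul_eq_mul]
    refine polar_max_principle (U := ℓ ∘ F) (Ur := ℓ ∘ Fr) (Urr := ℓ ∘ Frr) (Uw := ℓ ∘ Fw)
      (Uww := ℓ ∘ Fww) hγ hc (ℓ.continuous.comp_continuousOn hFS.continuousOn) ?_ ?_ ?_ ?_ ?_ ?_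
      hr w
    · intro r w
      simp only [Function.comp_apply, hF, polarPt_periodic r w]
    · exact fun r hr w => ℓ.hasFDerivAt.comp_hasDerivWithinAt r
        (hasDerivWithinAt_stripDeriv_fst hFS hr w)
    · exact fun r hr w => ℓ.hasFDerivAt.comp_hasDerivWithinAt r
        (hasDerivWithinAt_stripDeriv_fst hFr hr w)
    · exact fun r hr w => ℓ.hasFDerivAt.comp_hasDerivAt w (hasDerivAt_stripDeriv_snd hFS hr w)
    · exact fun r hr w => ℓ.hasFDerivAt.comp_hasDerivAt w (hasDerivAt_stripDeriv_snd hFw hr w)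
    · intro r hr w
      have := congrArg ℓ (hE w r hr)
      simpa only [E, Function.comp_apply, map_add, map_sub, hsmul, map_zero] using this
  intro z hz
  have hr : 0 < ‖z‖ := norm_pos_iff.mpr hz.2
  have hle := hre ((starRingEnd ℂ) (f z)) ‖z‖ ⟨hr, mem_closedBall_zero_iff.mp hz.1⟩ z.arg
  simp only [hF, polarPt_norm_arg] at hle
  rw [mul_comm, Complex.mul_conj, Complex.ofReal_re] at hle
  exact Complex.normSq_eq_zero.mp (le_antisymm hle (Complex.normSq_nonneg _))

theorem eqOn_of_Lop_add_eq {γ b : ℝ} (hγ : -1 < γ) (hb : -((1 + γ) ^ 2) < b) {f₁ f₂ : ℂ → ℂ}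
    (h₁ : CinfDisk f₁) (h₂ : CinfDisk f₂)
    (h : ∀ z ∈ Metric.closedBall (0 : ℂ) 1 \ {0},
      Lop γ f₁ z + (b : ℂ) * f₁ z = Lop γ f₂ z + (b : ℂ) * f₂ z) :
    Set.EqOn f₁ f₂ (Metric.closedBall 0 1) := by
  have hpunct : Set.EqOn f₁ f₂ (Metric.closedBall 0 1 \ {0}) := by
    have hz := eqOn_zero_of_Lop_add_eq_zero (f := fun z => -1 * f₂ z + f₁ z) hγ hb
      ((contDiffOn_const.mul h₂).add h₁) (fun z hz hz0 => by
        have hat : ∀ {f : ℂ → ℂ}, CinfDisk f → ContDiffAt ℝ 2 f z := fun hf =>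
          (ContDiffOn.contDiffAt hf (Filter.mem_of_superset (Metric.isOpen_ball.mem_nhds hz)
            Metric.ball_subset_closedBall)).of_le (WithTop.coe_le_coe.mpr (le_top : (2 : ℕ∞) ≤ ⊤))
        rw [Lop_const_mul_add γ (-1) hz0 (hat h₂) (hat h₁)]
        linear_combination h z ⟨Metric.ball_subset_closedBall hz, hz0⟩)
    intro z hz'
    have := hz hz'
    simp only [Pi.zero_apply] at this
    linear_combination this
  refine hpunct.of_subset_closure h₁.continuousOn h₂.continuousOn Set.sdiff_subset ?_
  intro z hz
  by_cases hz0 : z = 0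
  · subst hz0
    rw [Metric.mem_closure_iff]
    intro ε hε
    have hpos : 0 < min (ε / 2) 1 := lt_min (half_pos hε) one_pos
    refine ⟨((min (ε / 2) 1 : ℝ) : ℂ), ⟨?_, ?_⟩, ?_⟩
    · rw [mem_closedBall_zero_iff, Complex.norm_real, Real.norm_of_nonneg hpos.le]
      exact min_le_right _ _
    · exact Complex.ofReal_ne_zero.mpr hpos.ne'
    · rw [dist_zero_left, Complex.norm_real, Real.norm_of_nonneg hpos.le]
      exact (min_le_left _ _).trans_lt (half_lt_self hε)
  · exact subset_closure ⟨hz, hz0⟩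

/-- For any `b > -(1+γ)²` and `n ∈ ℕ`, the operator `𝓛_γ + b` maps `𝒫_n` into
itself, is injective on `C^∞(𝔻)`, and hence restricts to a linear isomorphism of `𝒫_n` onto
itself. (The polar-coordinate expression of `𝓛_γ` is used away from the origin `z = 0`, where it
determines the polynomial `(𝓛_γ + b) f` uniquely.) -/
theorem Lgamma_plus_b_on_polynomials (γ : ℝ) (hγ : -1 < γ) (b : ℝ) (hb : -((1 + γ) ^ 2) < b)
    (n : ℕ) :
    (∀ f ∈ Pspace n, ∃ g ∈ Pspace n, ∀ z : ℂ, z ≠ 0 → Lop γ f z + (b : ℂ) * f z = g z) ∧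
    (∀ f₁ f₂ : ℂ → ℂ, CinfDisk f₁ → CinfDisk f₂ →
      (∀ z ∈ Metric.closedBall (0 : ℂ) 1 \ {0},
        Lop γ f₁ z + (b : ℂ) * f₁ z = Lop γ f₂ z + (b : ℂ) * f₂ z) →
      Set.EqOn f₁ f₂ (Metric.closedBall 0 1)) ∧
    (∀ g ∈ Pspace n, ∃! f : ℂ → ℂ,
      f ∈ Pspace n ∧ ∀ z : ℂ, z ≠ 0 → Lop γ f z + (b : ℂ) * f z = g z) := by
  refine ⟨fun f hf => exists_mem_Pspace_Lop_add_eq γ b hf,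
    fun f₁ f₂ h₁ h₂ h => eqOn_of_Lop_add_eq hγ hb h₁ h₂ h, fun g hg => ?_⟩
  obtain ⟨f, hf, h⟩ := exists_preimage_mem_Pspace hγ hb hg
  refine ⟨f, ⟨hf, h⟩, fun f' ⟨hf', h'⟩ => eq_of_mem_Pspace_of_eqOn hf' hf ?_⟩
  exact eqOn_of_Lop_add_eq hγ hb (contDiff_of_mem_Pspace hf').contDiffOn
    (contDiff_of_mem_Pspace hf).contDiffOn fun z hz => (h' z hz.2).trans (h z hz.2).symm

end
end
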